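/- Consider a one-layered cake (the interval [0,1]) and n agents with closed preferences (agent n being the 'birthday agent'), and let q ≤ n be a prime power. Then there exists a division A = (A_1,…,A_q) of [0,1] into q pieces such that: each A_j is a union of q closed subintervals, one contained in each of the blocks [(ℓ−1)/q, ℓ/q], ℓ ∈ [q]; the multiset of lengths of the q subintervals constituting A_j is the same for every j (in particular every A_j has total length 1/q); and for every j* ∈ [q] there is an assignment π : [n] → [q] with π(n) = j*, π(i) ∈ c_i(A) for every i ∈ [n−1], and |π⁻¹(j)| ∈ {⌊n/q⌋, ⌈n/q⌉} for every j ∈ [q]. -/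

import Mathlib

open MeasureTheory

/-- A piece of cake: a finite union of closed subintervals of `[0,1]`. -/
def IsPiece (S : Set ℝ) : Prop :=
  ∃ I : Finset (ℝ × ℝ), (∀ p ∈ I, 0 ≤ p.1 ∧ p.2 ≤ 1) ∧ S = ⋃ p ∈ I, Set.Icc p.1 p.2

/-- A division of the one-layered cake `[0,1]` into `q` pieces: the pieces cover `[0,1]` and
have pairwise disjoint interiors. -/
def IsDivision1 {q : ℕ} (A : Fin q → Set ℝ) : Prop :=
  (∀ j, IsPiece (A j)) ∧ ((⋃ j, A j) = Set.Icc (0 : ℝ) 1) ∧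
  (∀ j j', j ≠ j' → interior (A j) ∩ interior (A j') = ∅)

/-- The symmetric-difference pseudo-metric on pieces of cake. -/
noncomputable def pieceDist (L L' : Set ℝ) : ℝ := (volume (symmDiff L L')).toReal

namespace CakeDivision

/-! ### Chains on words and their boundary -/

section Words

variable {K : Type*} [CommRing K] {α β : Type*}

/-- Formal linear combinations of words (finite lists). -/
abbrev Chain (K : Type*) [CommRing K] (α : Type*) := List α →₀ K

/-- A word, as a chain. -/
noncomputable abbrev word (K : Type*) [CommRing K] {α : Type*} (w : List α) : Chain K α :=
  Finsupp.single w 1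

/-- Prepending a letter, extended linearly. -/
noncomputable def consChain (K : Type*) [CommRing K] {α : Type*} (x : α) :
    Chain K α →ₗ[K] Chain K α :=
  Finsupp.lmapDomain K K (List.cons x)

/-- The alternating sum of the words obtained by deleting one letter. -/
noncomputable def wordBoundary (K : Type*) [CommRing K] {α : Type*} : List α → Chain K α
  | [] => 0
  | x :: w => word K w - consChain K x (wordBoundary K w)

/-- The (augmented) simplicial boundary on chains of words. -/
noncomputable def boundary (K : Type*) [CommRing K] (α : Type*) : Chain K α →ₗ[K] Chain K α :=
  Finsupp.linearCombination K (wordBoundary K)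

/-- Applying a map to every letter, extended linearly. -/
noncomputable def mapChain (K : Type*) [CommRing K] {α β : Type*} (f : α → β) :
    Chain K α →ₗ[K] Chain K β :=
  Finsupp.lmapDomain K K (List.map f)

@[simp] lemma consChain_single (x : α) (w : List α) (k : K) :
    consChain K x (Finsupp.single w k) = Finsupp.single (x :: w) k := by
  simp [consChain]

@[simp] lemma mapChain_single (f : α → β) (w : List α) (k : K) :
    mapChain K f (Finsupp.single w k) = Finsupp.single (w.map f) k := by
  simp [mapChain]

lemma consChain_word (x : α) (w : List α) : consChain K x (word K w) = word K (x :: w) :=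
  consChain_single x w 1

lemma boundary_word (w : List α) : boundary K α (word K w) = wordBoundary K w := by
  simp [boundary]

@[simp] lemma boundary_nil : boundary K α (word K []) = 0 := by
  simp [boundary_word, wordBoundary]

lemma chain_hom_ext {M : Type*} [AddCommMonoid M] [Module K M] {f g : Chain K α →ₗ[K] M}
    (h : ∀ w, f (word K w) = g (word K w)) : f = g := by
  refine Finsupp.lhom_ext' fun w => LinearMap.ext_ring ?_
  simpa using h w

lemma boundary_consChain (x : α) (c : Chain K α) :
    boundary K α (consChain K x c) = c - consChain K x (boundary K α c) := by
  have : boundary K α ∘ₗ consChain K x = LinearMap.id - consChain K x ∘ₗ boundary K α := by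
    refine chain_hom_ext fun w => ?_
    simp [boundary_word, wordBoundary]
  exact LinearMap.congr_fun this c

lemma boundary_cons (x : α) (w : List α) :
    boundary K α (word K (x :: w)) = word K w - consChain K x (boundary K α (word K w)) := by
  rw [← consChain_word, boundary_consChain]

lemma boundary_boundary (c : Chain K α) : boundary K α (boundary K α c) = 0 := by
  have : boundary K α ∘ₗ boundary K α = 0 := by
    refine chain_hom_ext fun w => ?_
    induction w with
    | nil => simp
    | cons x w ih =>
      simp only [LinearMap.comp_apply, LinearMap.zero_apply] at ih ⊢
      rw [boundary_cons, map_sub, boundary_consChain, ih]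
      simp
  exact LinearMap.congr_fun this c

lemma mapChain_consChain (f : α → β) (x : α) (c : Chain K α) :
    mapChain K f (consChain K x c) = consChain K (f x) (mapChain K f c) := by
  have : mapChain K f ∘ₗ consChain K x = consChain K (f x) ∘ₗ mapChain K f :=
    chain_hom_ext fun w => by simp
  exact LinearMap.congr_fun this c

lemma mapChain_boundary (f : α → β) (c : Chain K α) :
    mapChain K f (boundary K α c) = boundary K β (mapChain K f c) := by
  have : mapChain K f ∘ₗ boundary K α = boundary K β ∘ₗ mapChain K f := by
    refine chain_hom_ext fun w => ?_
    induction w with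
    | nil => simp
    | cons x w ih =>
      simp only [LinearMap.comp_apply, mapChain_single] at ih ⊢
      rw [boundary_cons, map_sub, mapChain_consChain, ih]
      simp [boundary_cons]
  exact LinearMap.congr_fun this c

lemma mapChain_comp {γ : Type*} (f : α → β) (g : β → γ) (c : Chain K α) :
    mapChain K g (mapChain K f c) = mapChain K (g ∘ f) c := by
  have : mapChain K g ∘ₗ mapChain K f = mapChain K (g ∘ f) :=
    chain_hom_ext fun w => by simp
  exact LinearMap.congr_fun this c

/-- To check that a linear map sends chains supported in `s` into a submodule, it suffices to
check words. -/
lemma map_mem_of_supported {M : Type*} [AddCommGroup M] [Module K M] (f : Chain K α →ₗ[K] M)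
    (s : Set (List α)) (N : Submodule K M) (h : ∀ w ∈ s, f (word K w) ∈ N) {c : Chain K α}
    (hc : c ∈ Finsupp.supported K K s) : f c ∈ N := by
  rw [Finsupp.supported_eq_span_single] at hc
  have : Submodule.span K ((fun i => Finsupp.single i (1 : K)) '' s) ≤ N.comap f := by
    rw [Submodule.span_le]
    rintro _ ⟨w, hw, rfl⟩
    exact h w hw
  exact this hc

lemma word_mem_supported {s : Set (List α)} {w : List α} (hw : w ∈ s) :
    word K w ∈ Finsupp.supported K K s :=
  Finsupp.single_mem_supported K 1 hw

lemma eq_of_supported {M : Type*} [AddCommGroup M] [Module K M] (f g : Chain K α →ₗ[K] M)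
    (s : Set (List α)) (h : ∀ w ∈ s, f (word K w) = g (word K w)) {c : Chain K α}
    (hc : c ∈ Finsupp.supported K K s) : f c = g c := by
  have := map_mem_of_supported (f - g) s ⊥ (fun w hw => by simp [h w hw]) hc
  simpa [sub_eq_zero] using this

lemma boundary_word_mem (w : List α) :
    boundary K α (word K w) ∈
      Finsupp.supported K K {v | v.Sublist w ∧ v.length + 1 = w.length} := by
  induction w with
  | nil => simp
  | cons x w ih =>
    rw [boundary_cons]
    refine sub_mem (word_mem_supported ⟨List.sublist_cons_self x w, by simp⟩) ?_
    refine map_mem_of_supported _ _ _ (fun v hv => ?_) ih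
    rw [consChain_single]
    exact word_mem_supported ⟨hv.1.cons_cons x, by simp [hv.2]⟩

end Words

/-! ### Acyclicity of the complex of injective words -/

section InjectiveWords

variable {K : Type*} [CommRing K] {α : Type*}

/-- The injective words of length `l` with letters in `S`. -/
def injWords (S : Finset α) (l : ℕ) : Set (List α) :=
  {w | w.Nodup ∧ (∀ x ∈ w, x ∈ S) ∧ w.length = l}

lemma boundary_mem_injWords {S : Finset α} {l : ℕ} {c : Chain K α}
    (hc : c ∈ Finsupp.supported K K (injWords S (l + 1))) :
    boundary K α c ∈ Finsupp.supported K K (injWords S l) := by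
  refine map_mem_of_supported _ _ _ (fun w hw => ?_) hc
  refine Finsupp.supported_mono ?_ (boundary_word_mem w)
  rintro v ⟨hv, hl⟩
  exact ⟨hw.1.sublist hv, fun x hx => hw.2.1 x (hv.subset hx), by have := hw.2.2; omega⟩

/-- Coefficients of the words beginning with a given word. -/
noncomputable def strip (K : Type*) [CommRing K] {α : Type*} (u : List α) :
    Chain K α →ₗ[K] Chain K α :=
  Finsupp.lcomapDomain (fun v => u ++ v) (List.append_right_injective u)

@[simp] lemma strip_apply (u : List α) (c : Chain K α) (v : List α) :
    strip K u c v = c (u ++ v) := rfl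

/-- Removing the first letter of every word. -/
noncomputable def tailChain (K : Type*) [CommRing K] {α : Type*} : Chain K α →ₗ[K] Chain K α :=
  Finsupp.linearCombination K fun w => match w with
    | [] => 0
    | _ :: w => word K w

lemma strip_singleton_boundary (x : α) (c : Chain K α) :
    strip K [x] (boundary K α c) =
      strip K [x] (tailChain K c) - boundary K α (strip K [x] c) := by
  classical
  have : strip K [x] ∘ₗ boundary K α =
      strip K [x] ∘ₗ tailChain K - boundary K α ∘ₗ strip K [x] := by
    refine chain_hom_ext fun w => ?_
    cases w with
    | nil =>
      have : strip K [x] (word K ([] : List α)) = 0 := by ext v; simp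
      simp [this, tailChain]
    | cons y w =>
      simp only [LinearMap.comp_apply, LinearMap.sub_apply, boundary_cons, map_sub]
      have h1 : tailChain K (word K (y :: w)) = word K w := by simp [tailChain]
      have h2 : ∀ c : Chain K α, strip K [x] (consChain K y c) = if y = x then c else 0 := by
        intro c
        have : strip K [x] ∘ₗ consChain K y = if y = x then LinearMap.id else 0 := by
          refine chain_hom_ext fun w => ?_
          ext v
          by_cases h : y = x <;> simp [h, Finsupp.single_apply]
        have := LinearMap.congr_fun this c
        split_ifs at this ⊢ <;> simpa using this
      rw [h1, h2, ← consChain_word, h2]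
      split_ifs <;> simp
  exact LinearMap.congr_fun this c

lemma tailChain_apply_eq_zero (c : Chain K α) (w : List α) (h : ∀ y, c (y :: w) = 0) :
    tailChain K c w = 0 := by
  classical
  rw [tailChain, Finsupp.linearCombination_apply, Finsupp.sum, Finsupp.finsetSum_apply]
  refine Finset.sum_eq_zero fun v _ => ?_
  cases v with
  | nil => simp
  | cons y v =>
    by_cases hv : v = w
    · subst hv; simp [h]
    · simp [hv]

lemma strip_cons (x : α) (u : List α) (c : Chain K α) :
    strip K (x :: u) c = strip K u (strip K [x] c) := by
  ext v; simp

/-- The part of the boundary with a distinguished letter `a` preceded by `u` comes from deletions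
behind `a`, as long as `a` never occurs one place further. -/
lemma strip_boundary (a : α) (u : List α) (c : Chain K α)
    (h : ∀ w, c w ≠ 0 → w[u.length + 1]? ≠ some a) :
    strip K (u ++ [a]) (boundary K α c) =
      (-1 : K) ^ (u.length + 1) • boundary K α (strip K (u ++ [a]) c) := by
  induction u generalizing c with
  | nil =>
    simp only [List.nil_append, strip_singleton_boundary]
    have : strip K [a] (tailChain K c) = 0 := by
      ext v
      refine tailChain_apply_eq_zero _ _ fun y => ?_
      by_contra hy
      exact h _ hy (by simp)
    simp [this]
  | cons x u ih =>
    rw [List.cons_append, strip_cons, strip_singleton_boundary, map_sub, ih]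
    · have : strip K (u ++ [a]) (strip K [x] (tailChain K c)) = 0 := by
        ext v
        refine tailChain_apply_eq_zero _ _ fun y => ?_
        by_contra hy
        exact h _ hy (by simp)
      rw [this, strip_cons x (u ++ [a]) c]
      simp [pow_succ]
    · intro w hw
      have := h _ hw
      simpa using this

/-- The complex of injective words on `S` has no homology below its top degree. -/
theorem exists_boundary_eq_of_cycle [DecidableEq α] (S : Finset α) :
    ∀ (l : ℕ), l < S.card → ∀ z : Chain K α, z ∈ Finsupp.supported K K (injWords S l) →
      boundary K α z = 0 →
      ∃ c ∈ Finsupp.supported K K (injWords S (l + 1)), boundary K α c = z := by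
  induction S using Finset.strongInduction with
  | H S IH =>
  intro l hl
  obtain ⟨a, ha⟩ : S.Nonempty := Finset.card_pos.1 (by omega)
  have key : ∀ i, ∀ z : Chain K α, z ∈ Finsupp.supported K K (injWords S l) →
      boundary K α z = 0 → (∀ w : List α, z w ≠ 0 → ∀ j : ℕ, i < j → w[j]? ≠ some a) →
      ∃ c ∈ Finsupp.supported K K (injWords S (l + 1)), boundary K α c = z := by
    intro i
    induction i with
    | zero =>
      intro z hz hbz hi
      rw [Finsupp.mem_supported'] at hz
      have hmem : ∀ w, z w ≠ 0 → w ∈ injWords S l := fun w hw => by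
        by_contra h; exact hw (hz w h)
      set z₁ := strip K [a] z with hz₁
      set z₀ := z - consChain K a z₁ with hz₀
      have hcons : ∀ (c : Chain K α) (x : α) (v : List α),
          consChain K a c (x :: v) = if a = x then c v else 0 := by
        intro c x v
        by_cases hx : a = x
        · subst hx
          simp only [consChain, Finsupp.lmapDomain_apply, if_true]
          exact Finsupp.mapDomain_apply List.cons_injective c v
        · rw [if_neg hx]
          simp only [consChain, Finsupp.lmapDomain_apply]
          refine Finsupp.mapDomain_of_notMem_range c _ ?_
          rintro ⟨w, hw⟩
          simp at hw
          exact hx hw.1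
      have hconsnil : ∀ (c : Chain K α), consChain K a c [] = 0 := by
        intro c
        simp only [consChain, Finsupp.lmapDomain_apply]
        refine Finsupp.mapDomain_of_notMem_range c _ ?_
        rintro ⟨w, hw⟩
        simp at hw
      have h0 : ∀ w, z₀ w ≠ 0 → w ∈ injWords S l ∧ a ∉ w := by
        intro w hw
        cases w with
        | nil =>
          rw [hz₀] at hw
          simp only [Finsupp.sub_apply, hconsnil, sub_zero] at hw
          exact ⟨hmem _ hw, by simp⟩
        | cons x v =>
          rw [hz₀] at hw
          simp only [Finsupp.sub_apply, hcons] at hw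
          by_cases hx : a = x
          · subst hx; simp [hz₁] at hw
          · rw [if_neg hx, sub_zero] at hw
            refine ⟨hmem _ hw, fun hav => ?_⟩
            obtain ⟨j, hj, hja⟩ := List.getElem_of_mem hav
            rcases j with _ | j
            · exact hx (by simpa using hja.symm)
            · exact hi _ hw (j + 1) (by omega) (by rw [List.getElem?_eq_getElem hj, hja])
      have h1 : ∀ w, z₁ w ≠ 0 → a ∉ w := by
        intro w hw
        have := (hmem (a :: w) (by simpa [hz₁] using hw)).1
        exact (List.nodup_cons.1 this).1
      have h0b : ∀ w, boundary K α z₀ w ≠ 0 → a ∉ w := by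
        have : boundary K α z₀ ∈ Finsupp.supported K K {w | a ∉ w} := by
          refine map_mem_of_supported _ {w | a ∉ w} _ (fun w hw => ?_) ?_
          · refine Finsupp.supported_mono ?_ (boundary_word_mem w)
            exact fun v hv hav => hw (hv.1.subset hav)
          · rw [Finsupp.mem_supported']
            intro w hw
            by_contra h
            exact hw (h0 w h).2
        intro w hw hav
        exact hw ((Finsupp.mem_supported' K _).1 this w (by simpa using hav))
      have hz01 : z = z₀ + consChain K a z₁ := by rw [hz₀]; abel
      have hsum : boundary K α z₀ + z₁ - consChain K a (boundary K α z₁) = 0 := by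
        rw [← hbz, hz01, map_add, boundary_consChain]; abel
      have hb1 : boundary K α z₁ = 0 := by
        ext v
        have := DFunLike.congr_fun hsum (a :: v)
        simp only [Finsupp.sub_apply, Finsupp.add_apply, hcons, if_true, Finsupp.zero_apply] at this
        have e1 : boundary K α z₀ (a :: v) = 0 := by
          by_contra h; exact h0b _ h (by simp)
        have e2 : z₁ (a :: v) = 0 := by
          by_contra h; exact h1 _ h (by simp)
        rw [e1, e2] at this
        simpa using this
      have hb0 : boundary K α z₀ = - z₁ := by
        rw [hb1] at hsum
        simp at hsum
        exact eq_neg_of_add_eq_zero_left hsum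
      refine ⟨consChain K a z₀, ?_, ?_⟩
      · refine map_mem_of_supported _ {w | w ∈ injWords S l ∧ a ∉ w} _ (fun w hw => ?_) ?_
        · rw [consChain_single]
          refine word_mem_supported ⟨List.nodup_cons.2 ⟨hw.2, hw.1.1⟩, ?_, by simp [hw.1.2.2]⟩
          intro x hx
          rcases List.mem_cons.1 hx with rfl | hx
          · exact ha
          · exact hw.1.2.1 x hx
        · rw [Finsupp.mem_supported']
          intro w hw
          by_contra h
          exact hw (h0 w h)
      · rw [boundary_consChain, hb0, map_neg, sub_neg_eq_add, ← hz01]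
    | succ i ih =>
      intro z hz hbz hi
      have hz' := (Finsupp.mem_supported' K _).1 hz
      have hmem : ∀ w, z w ≠ 0 → w ∈ injWords S l := fun w hw => by
        by_contra h; exact hw (hz' w h)
      have hy : ∀ u : List α, ∃ y : Chain K α, u.length = i + 1 →
          boundary K α y = (-1 : K) ^ (i + 2) • strip K (u ++ [a]) z ∧
          ∀ v, y v ≠ 0 → u ++ a :: v ∈ injWords S (l + 1) := by
        intro u
        by_cases hu : u.length = i + 1
        swap
        · exact ⟨0, fun h => absurd h hu⟩
        by_cases hzu : strip K (u ++ [a]) z = 0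
        · exact ⟨0, fun _ => by simp [hzu]⟩
        obtain ⟨v₀, hv₀⟩ : ∃ v₀, z (u ++ a :: v₀) ≠ 0 := by
          by_contra! h
          exact hzu (by ext v; simp [h v])
        have hv₀' := hmem _ hv₀
        set S' := (S.erase a) \ u.toFinset with hS'
        have hau : a ∉ u ∧ u.Nodup := by
          have := hv₀'.1
          rw [List.nodup_append] at this
          exact ⟨fun h => this.2.2 a h a (by simp) rfl, this.1⟩
        have huS : ∀ x ∈ u, x ∈ S := fun x hx => hv₀'.2.1 x (by simp [hx])
        have hcard : S'.card + (i + 1) + 1 = S.card := by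
          have h1 : u.toFinset ⊆ S.erase a := by
            intro x hx
            rw [List.mem_toFinset] at hx
            exact Finset.mem_erase.2 ⟨fun h => hau.1 (h ▸ hx), huS x hx⟩
          have h2 := Finset.card_sdiff_add_card_eq_card h1
          rw [List.toFinset_card_of_nodup hau.2, hu] at h2
          have := Finset.card_erase_add_one ha
          rw [← hS'] at h2
          omega
        have hlen : v₀.length + (i + 1) + 1 = l := by
          have := hv₀'.2.2
          simp at this; omega
        have hsub : ∀ (m : ℕ) (v : List α), v ∈ injWords S' m ↔
            u ++ a :: v ∈ injWords S (m + (i + 1) + 1) := by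
          intro m v
          have hmemS' : ∀ x, x ∈ S' ↔ (x ≠ a ∧ x ∈ S) ∧ x ∉ u := by
            intro x; simp [hS']
          constructor
          · rintro ⟨h1, h2, h3⟩
            refine ⟨?_, ?_, by simp [h3, hu]; omega⟩
            · rw [List.nodup_append]
              refine ⟨hau.2, List.nodup_cons.2 ⟨fun h => ((hmemS' a).1 (h2 a h)).1.1 rfl, h1⟩, ?_⟩
              intro x hx y hy hxy
              subst hxy
              rcases List.mem_cons.1 hy with rfl | hy
              · exact hau.1 hx
              · exact ((hmemS' x).1 (h2 x hy)).2 hx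
            · intro x hx
              rcases List.mem_append.1 hx with hx | hx
              · exact huS x hx
              · rcases List.mem_cons.1 hx with rfl | hx
                · exact ha
                · exact ((hmemS' x).1 (h2 x hx)).1.2
          · rintro ⟨h1, h2, h3⟩
            rw [List.nodup_append, List.nodup_cons] at h1
            refine ⟨h1.2.1.2, fun x hx => ?_, by simp [hu] at h3; omega⟩
            rw [hmemS']
            refine ⟨⟨?_, h2 x (by simp [hx])⟩, ?_⟩
            · rintro rfl; exact h1.2.1.1 hx
            · intro hxu; exact h1.2.2 x hxu x (by simp [hx]) rfl
        have hSS : S' ⊂ S :=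
          (Finset.sdiff_subset).trans_ssubset (Finset.erase_ssubset ha)
        have hcyc : boundary K α (strip K (u ++ [a]) z) = 0 := by
          have := strip_boundary a u z (fun w hw => hi w hw _ (by omega))
          rw [hbz, map_zero] at this
          have h2 := congrArg (fun c => (-1 : K) ^ (u.length + 1) • c) this.symm
          simpa [smul_smul, ← pow_add, ← two_mul] using h2
        obtain ⟨y, hy1, hy2⟩ := IH S' hSS v₀.length (by omega)
          ((-1 : K) ^ (i + 2) • strip K (u ++ [a]) z) (by
            refine Submodule.smul_mem _ _ ?_
            rw [Finsupp.mem_supported']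
            intro v hv
            by_contra h
            refine hv ((hsub _ v).2 ?_)
            rw [hlen]
            refine hmem _ ?_
            simpa using h) (by rw [map_smul, hcyc, smul_zero])
        refine ⟨y, fun _ => ⟨hy2, fun v hv => ?_⟩⟩
        have hv' : v ∈ injWords S' (v₀.length + 1) := by
          by_contra h
          exact hv ((Finsupp.mem_supported' K _).1 hy1 v h)
        have := (hsub _ v).1 hv'
        rwa [show v₀.length + 1 + (i + 1) + 1 = l + 1 by omega] at this
      choose y hy using hy
      set U : Finset (List α) := (z.support.image (List.take (i + 1))).filter
        (fun u => u.length = i + 1) with hU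
      set c : Chain K α := ∑ u ∈ U, Finsupp.mapDomain (fun v => u ++ a :: v) (y u) with hc
      have hinj : ∀ u : List α, Function.Injective (fun v => u ++ a :: v) := by
        intro u v v' h
        simpa using h
      have hUlen : ∀ u ∈ U, u.length = i + 1 := fun u hu => (Finset.mem_filter.1 hu).2
      have hcsupp : c ∈ Finsupp.supported K K
          {w | w ∈ injWords S (l + 1) ∧ w[i + 1]? = some a} := by
        refine Submodule.sum_mem _ fun u hu => ?_
        rw [Finsupp.mem_supported']
        intro w hw
        by_contra h
        have hr : w ∈ Set.range (fun v => u ++ a :: v) := by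
          by_contra h'
          exact h (Finsupp.mapDomain_of_notMem_range _ _ h')
        obtain ⟨v, rfl⟩ := hr
        rw [Finsupp.mapDomain_apply (hinj u)] at h
        refine hw ⟨(hy u (hUlen u hu)).2 v h, ?_⟩
        simp [← hUlen u hu]
      have hcmem : ∀ w, c w ≠ 0 → w ∈ injWords S (l + 1) ∧ w[i + 1]? = some a := by
        intro w hw
        by_contra h
        exact hw ((Finsupp.mem_supported' K _).1 hcsupp w h)
      have hstripc : ∀ u, u.length = i + 1 →
          strip K (u ++ [a]) c = if u ∈ U then y u else 0 := by
        intro u hu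
        ext v
        rw [hc, strip_apply, Finsupp.finsetSum_apply]
        have : ∀ u' ∈ U, Finsupp.mapDomain (fun v => u' ++ a :: v) (y u') (u ++ [a] ++ v) =
            if u = u' then y u v else 0 := by
          intro u' hu'
          split_ifs with h
          · subst h
            rw [List.append_assoc]
            exact Finsupp.mapDomain_apply (hinj u) (y u) v
          · refine Finsupp.mapDomain_of_notMem_range _ _ ?_
            rintro ⟨v', hv'⟩
            have := List.append_inj_left (t₁ := a :: v') (t₂ := a :: v) (s₁ := u') (s₂ := u)
              (by simpa using hv') (by rw [hu, hUlen u' hu'])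
            exact h this.symm
        rw [Finset.sum_congr rfl this, Finset.sum_ite_eq]
        split_ifs <;> rfl
      have hbc : ∀ u, u.length = i + 1 →
          strip K (u ++ [a]) (boundary K α c) = strip K (u ++ [a]) z := by
        intro u hu
        rw [strip_boundary a u c, hstripc u hu]
        · split_ifs with h
          · rw [(hy u hu).1, hu, smul_smul, ← pow_add, ← two_mul]
            simp
          · rw [map_zero, smul_zero]
            symm
            ext v
            by_contra hv
            refine h (Finset.mem_filter.2 ⟨Finset.mem_image.2 ⟨u ++ a :: v, ?_, ?_⟩, hu⟩)
            · simpa using hv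
            · rw [← hu]; simp
        · intro w hw hwa
          obtain ⟨h1, h2⟩ := hcmem w hw
          have hn := h1.1
          rw [hu] at hwa
          rw [List.nodup_iff_getElem?_ne_getElem?] at hn
          have hlt : i + 1 + 1 < w.length := by
            by_contra h
            rw [List.getElem?_eq_none (by omega)] at hwa
            simp at hwa
          exact hn (i + 1) (i + 1 + 1) (by omega) hlt (by rw [h2, hwa])
      have hbcsupp : boundary K α c ∈ Finsupp.supported K K
          {w | ∀ j, i + 1 < j → w[j]? ≠ some a} := by
        refine map_mem_of_supported _ _ _ (fun w hw => ?_) hcsupp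
        refine Finsupp.supported_mono ?_ (boundary_word_mem w)
        intro v hv j hj hva
        obtain ⟨⟨hn, -, -⟩, hwa⟩ := hw
        have hjl : j < v.length := by
          by_contra h
          rw [List.getElem?_eq_none (by omega)] at hva
          simp at hva
        obtain ⟨f, hf⟩ := List.sublist_iff_exists_orderEmbedding_getElem?_eq.1 hv.1
        have h1 := hf j
        rw [hva] at h1
        have hfj : j ≤ f j := f.strictMono.le_apply
        have hfl : f j < w.length := by
          by_contra h
          rw [List.getElem?_eq_none (by omega)] at h1
          simp at h1
        rw [List.nodup_iff_getElem?_ne_getElem?] at hn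
        exact hn (i + 1) (f j) (by omega) hfl (by rw [hwa, ← h1])
      have hcS : c ∈ Finsupp.supported K K (injWords S (l + 1)) :=
        Finsupp.supported_mono (fun w hw => hw.1) hcsupp
      obtain ⟨c', hc', hbc'⟩ := ih (z - boundary K α c)
        (sub_mem hz (boundary_mem_injWords hcS)) (by
          rw [map_sub, hbz, boundary_boundary, sub_zero]) (by
          intro w hw j hj hwa
          rcases Nat.lt_or_ge (i + 1) j with hj' | hj'
          · refine hw ?_
            have e1 : z w = 0 := by
              by_contra h; exact hi w h j hj' hwa
            have e2 : boundary K α c w = 0 := by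
              by_contra h
              exact h ((Finsupp.mem_supported' K _).1 hbcsupp w (fun h' => h' j hj' hwa))
            rw [Finsupp.sub_apply, e1, e2, sub_zero]
          · have hji : j = i + 1 := by omega
            subst hji
            have hjl : i + 1 < w.length := by
              by_contra h
              rw [List.getElem?_eq_none (by omega)] at hwa
              simp at hwa
            have hdec : w = w.take (i + 1) ++ [a] ++ w.drop (i + 2) := by
              rw [List.getElem?_eq_getElem hjl] at hwa
              have : w[i + 1] = a := by simpa using hwa
              conv_lhs => rw [← List.take_append_drop (i + 1) w, List.drop_eq_getElem_cons hjl, this]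
              simp
            refine hw ?_
            have := DFunLike.congr_fun (hbc (w.take (i + 1)) (by simp; omega)) (w.drop (i + 2))
            rw [strip_apply, strip_apply, ← hdec] at this
            rw [Finsupp.sub_apply, this, sub_self])
      exact ⟨c' + c, add_mem hc' hcS, by rw [map_add, hbc']; abel⟩
  intro z hz hbz
  refine key l z hz hbz fun w hw j hj => ?_
  have : w ∈ injWords S l := by
    by_contra h; exact hw ((Finsupp.mem_supported' K _).1 hz w h)
  rw [List.getElem?_eq_none (by have := this.2.2; omega)]
  simp

end InjectiveWords

/-! ### Alternating chains -/

section Alternating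

variable {K : Type*} [Field K] {α β : Type*}

/-- The relations turning words into oriented simplices. -/
noncomputable def altRel (K : Type*) [Field K] (α : Type*) : Submodule K (Chain K α) :=
  Submodule.span K
    ({c | ∃ u x y v, c = word K (u ++ x :: y :: v) + word K (u ++ y :: x :: v)} ∪
      {c | ∃ u x v, c = word K (u ++ x :: x :: v)})

/-- Alternating chains: oriented simplices on the vertex set `α`. -/
abbrev AltChain (K : Type*) [Field K] (α : Type*) := Chain K α ⧸ altRel K α

/-- The oriented simplex given by a word. -/
noncomputable def altWord (K : Type*) [Field K] {α : Type*} (w : List α) : AltChain K α :=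
  (altRel K α).mkQ (word K w)

lemma altRel_swap_mem (u : List α) (x y : α) (v : List α) :
    word K (u ++ x :: y :: v) + word K (u ++ y :: x :: v) ∈ altRel K α :=
  Submodule.subset_span (Or.inl ⟨u, x, y, v, rfl⟩)

lemma altRel_rep_mem (u : List α) (x : α) (v : List α) :
    word K (u ++ x :: x :: v) ∈ altRel K α :=
  Submodule.subset_span (Or.inr ⟨u, x, v, rfl⟩)

lemma altRel_map_mem {f : Chain K α →ₗ[K] Chain K β}
    (h1 : ∀ u x y v, f (word K (u ++ x :: y :: v)) + f (word K (u ++ y :: x :: v)) ∈ altRel K β)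
    (h2 : ∀ u x v, f (word K (u ++ x :: x :: v)) ∈ altRel K β) :
    ∀ r ∈ altRel K α, f r ∈ altRel K β := by
  have : altRel K α ≤ (altRel K β).comap f := by
    refine Submodule.span_le.2 ?_
    rintro _ (⟨u, x, y, v, rfl⟩ | ⟨u, x, v, rfl⟩)
    · simpa only [SetLike.mem_coe, Submodule.mem_comap, map_add] using h1 u x y v
    · exact h2 u x v
  exact this

lemma altRel_consChain (a : α) : ∀ r ∈ altRel K α, consChain K a r ∈ altRel K α := by
  refine altRel_map_mem (fun u x y v => ?_) (fun u x v => ?_)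
  · simpa only [consChain_word, List.cons_append] using altRel_swap_mem (a :: u) x y v
  · simpa only [consChain_word, List.cons_append] using altRel_rep_mem (a :: u) x v

lemma altRel_mapChain (f : α → β) : ∀ r ∈ altRel K α, mapChain K f r ∈ altRel K β := by
  refine altRel_map_mem (fun u x y v => ?_) (fun u x v => ?_)
  · simpa using altRel_swap_mem (K := K) (u.map f) (f x) (f y) (v.map f)
  · simpa using altRel_rep_mem (K := K) (u.map f) (f x) (v.map f)

lemma altRel_cons_cons_swap (x y : α) (c : Chain K α) :
    consChain K x (consChain K y c) + consChain K y (consChain K x c) ∈ altRel K α := by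
  refine map_mem_of_supported
    (consChain K x ∘ₗ consChain K y + consChain K y ∘ₗ consChain K x) Set.univ (altRel K α)
    (fun w _ => ?_) (by simp)
  simpa using altRel_swap_mem (K := K) [] x y w

lemma altRel_cons_cons_self (x : α) (c : Chain K α) :
    consChain K x (consChain K x c) ∈ altRel K α := by
  refine map_mem_of_supported (consChain K x ∘ₗ consChain K x) Set.univ (altRel K α)
    (fun w _ => ?_) (by simp)
  simpa using altRel_rep_mem (K := K) [] x w

lemma altRel_boundary : ∀ r ∈ altRel K α, boundary K α r ∈ altRel K α := by
  refine altRel_map_mem (fun u x y v => ?_) (fun u x v => ?_)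
  · rw [← map_add]
    induction u with
    | nil =>
      have := altRel_cons_cons_swap x y (boundary K α (word K v))
      simp only [List.nil_append, map_add, boundary_cons, map_sub, consChain_word]
      convert this using 1
      abel
    | cons a u ih =>
      have := sub_mem (altRel_swap_mem (K := K) u x y v) (altRel_consChain a _ ih)
      rwa [← boundary_consChain, map_add, consChain_word, consChain_word] at this
  · induction u with
    | nil =>
      have := altRel_cons_cons_self x (boundary K α (word K v))
      simp only [List.nil_append, boundary_cons, map_sub, consChain_word]
      convert this using 1
      abel
    | cons a u ih =>
      have := sub_mem (altRel_rep_mem (K := K) u x v) (altRel_consChain a _ ih)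
      rwa [← boundary_consChain, consChain_word] at this

/-- Operators acting on each word in a way that depends only on its multiset of letters. -/
noncomputable def twist (O : Multiset α → Module.End K (Chain K α)) : Module.End K (Chain K α) :=
  Finsupp.linearCombination K fun w => O (w : Multiset α) (word K w)

lemma twist_word (O : Multiset α → Module.End K (Chain K α)) (w : List α) :
    twist O (word K w) = O (w : Multiset α) (word K w) := by
  simp [twist]

lemma altRel_twist (O : Multiset α → Module.End K (Chain K α))
    (hO : ∀ s, ∀ r ∈ altRel K α, O s r ∈ altRel K α) :
    ∀ r ∈ altRel K α, twist O r ∈ altRel K α := by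
  refine altRel_map_mem (fun u x y v => ?_) (fun u x v => ?_)
  · have : ((u ++ x :: y :: v : List α) : Multiset α) = (u ++ y :: x :: v : List α) :=
      Multiset.coe_eq_coe.2 ((List.Perm.swap y x v).append_left u)
    rw [twist_word, twist_word, this, ← map_add]
    exact hO _ _ (altRel_swap_mem u x y v)
  · rw [twist_word]
    exact hO _ _ (altRel_rep_mem u x v)

/-- Words with a repeated letter are degenerate. -/
lemma altWord_eq_zero {w : List α} (hw : ¬ w.Nodup) : altWord K w = 0 := by
  rw [altWord, Submodule.mkQ_apply, Submodule.Quotient.mk_eq_zero]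
  have mem : ∀ (x : α) (w : List α), x ∈ w → word K (x :: w) ∈ altRel K α := by
    intro x w
    induction w with
    | nil => simp
    | cons y v ih =>
      intro hx
      by_cases hxy : x = y
      · subst hxy
        exact altRel_rep_mem [] x v
      · have h1 := altRel_consChain y _ (ih (by simpa [hxy] using hx))
        have h2 := sub_mem (altRel_swap_mem (K := K) [] x y v) h1
        simpa using h2
  induction w with
  | nil => simp at hw
  | cons x w ih =>
    by_cases hx : x ∈ w
    · exact mem x w hx
    · rw [← consChain_word]
      exact altRel_consChain x _ (ih fun h => hw (List.nodup_cons.2 ⟨hx, h⟩))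

lemma alt_hom_ext {M : Type*} [AddCommGroup M] [Module K M] {f g : AltChain K α →ₗ[K] M}
    (h : ∀ w, f (altWord K w) = g (altWord K w)) : f = g := by
  refine Submodule.linearMap_qext _ (chain_hom_ext fun w => ?_)
  exact h w

/-- The operator on alternating chains induced by an operator on chains. -/
noncomputable def altDesc (f : Chain K α →ₗ[K] Chain K β)
    (hf : ∀ r ∈ altRel K α, f r ∈ altRel K β) : AltChain K α →ₗ[K] AltChain K β :=
  (altRel K α).mapQ (altRel K β) f hf

lemma altDesc_altWord (f : Chain K α →ₗ[K] Chain K β)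
    (hf : ∀ r ∈ altRel K α, f r ∈ altRel K β) (w : List α) :
    altDesc f hf (altWord K w) = (altRel K β).mkQ (f (word K w)) := rfl

lemma altDesc_mkQ (f : Chain K α →ₗ[K] Chain K β)
    (hf : ∀ r ∈ altRel K α, f r ∈ altRel K β) (c : Chain K α) :
    altDesc f hf ((altRel K α).mkQ c) = (altRel K β).mkQ (f c) := rfl

/-- The boundary of alternating chains. -/
noncomputable def altBoundary (K : Type*) [Field K] (α : Type*) :
    AltChain K α →ₗ[K] AltChain K α :=
  altDesc (boundary K α) altRel_boundary

/-- Coning off alternating chains. -/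
noncomputable def altCone (K : Type*) [Field K] {α : Type*} (a : α) :
    AltChain K α →ₗ[K] AltChain K α :=
  altDesc (consChain K a) (altRel_consChain a)

/-- The diagonal operator with weights depending on the multiset of letters. -/
noncomputable def altDiag (c : Multiset α → K) : AltChain K α →ₗ[K] AltChain K α :=
  altDesc (twist fun s => c s • LinearMap.id)
    (altRel_twist _ fun _ _ hr => Submodule.smul_mem _ _ hr)

lemma altDiag_altWord (c : Multiset α → K) (w : List α) :
    altDiag c (altWord K w) = c w • altWord K w := by
  rw [altDiag, altDesc_altWord, twist_word]
  rfl

lemma altBoundary_mkQ (c : Chain K α) :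
    altBoundary K α ((altRel K α).mkQ c) = (altRel K α).mkQ (boundary K α c) := rfl

lemma altBoundary_cone (a : α) (d : AltChain K α) :
    altBoundary K α (altCone K a d) = d - altCone K a (altBoundary K α d) := by
  obtain ⟨c, rfl⟩ := (altRel K α).mkQ_surjective d
  rw [altCone, altDesc_mkQ, altBoundary_mkQ, boundary_consChain, altBoundary_mkQ, altDesc_mkQ,
    map_sub]

instance [Finite α] : Module.Finite K (AltChain K α) := by
  have hfin : {w : List α | w.Nodup}.Finite := by
    cases nonempty_fintype α
    classical
    refine Set.Finite.subset (List.finite_length_le α (Fintype.card α)) fun w hw => ?_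
    exact List.Nodup.length_le_card hw
  refine ⟨⟨(hfin.image (altWord K)).toFinset, ?_⟩⟩
  rw [eq_top_iff]
  rintro d -
  obtain ⟨c, rfl⟩ := (altRel K α).mkQ_surjective d
  refine map_mem_of_supported (altRel K α).mkQ Set.univ _ (fun w _ => ?_) (by simp)
  by_cases hw : w.Nodup
  · exact Submodule.subset_span (by simpa using ⟨w, hw, rfl⟩)
  · change altWord K w ∈ _
    rw [altWord_eq_zero hw]
    exact zero_mem _

/-- The coefficient of the empty word. -/
noncomputable def altAug (K : Type*) [Field K] (α : Type*) : AltChain K α →ₗ[K] K :=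
  (altRel K α).liftQ (Finsupp.lapply []) (by
    refine Submodule.span_le.2 ?_
    rintro _ (⟨u, x, y, v, rfl⟩ | ⟨u, x, v, rfl⟩) <;> simp)

lemma altAug_altWord (w : List α) : altAug K α (altWord K w) = if w = [] then 1 else 0 := by
  classical
  change Finsupp.single w (1 : K) [] = _
  rw [Finsupp.single_apply]

/-- A linear map commuting with the boundary has zero supertrace, since alternating chains
(with augmentation) form a contractible complex. -/
lemma supertrace_eq_zero [Finite α] [Nonempty α] (φ : AltChain K α →ₗ[K] AltChain K α)
    (hφ : altBoundary K α ∘ₗ φ = φ ∘ₗ altBoundary K α) :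
    LinearMap.trace K _ (altDiag (fun s => (-1 : K) ^ Multiset.card s) ∘ₗ φ) = 0 := by
  obtain ⟨a⟩ := ‹Nonempty α›
  set ε := altDiag (K := K) (α := α) (fun s => (-1 : K) ^ Multiset.card s) with hε
  set b := altBoundary K α
  set h := altCone K a
  have hbh : b ∘ₗ h + h ∘ₗ b = LinearMap.id := by
    refine LinearMap.ext fun d => ?_
    change b (h d) + h (b d) = d
    rw [altBoundary_cone]
    abel
  have hεb : b ∘ₗ ε = - (ε ∘ₗ b) := by
    refine alt_hom_ext fun w => ?_
    simp only [LinearMap.comp_apply, LinearMap.neg_apply, hε, altDiag_altWord, map_smul]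
    have key : ∀ c ∈ Finsupp.supported K K {v : List α | v.Sublist w ∧ v.length + 1 = w.length},
        altDiag (fun s => (-1 : K) ^ Multiset.card s) ((altRel K α).mkQ c) =
          (-(-1) ^ w.length : K) • (altRel K α).mkQ c := by
      intro c hc
      refine eq_of_supported
        (altDiag (fun s => (-1 : K) ^ Multiset.card s) ∘ₗ (altRel K α).mkQ)
        ((-(-1) ^ w.length : K) • (altRel K α).mkQ) _ (fun v hv => ?_) hc
      change altDiag (fun s => (-1 : K) ^ Multiset.card s) (altWord K v) =
        (-(-1) ^ w.length : K) • altWord K v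
      rw [altDiag_altWord, ← hv.2]
      simp [pow_succ]
    have h2 := key _ (boundary_word_mem w)
    change _ • b (altWord K w) = - (altDiag _ (altRel K α |>.mkQ (boundary K α (word K w))))
    rw [h2]
    simp only [neg_smul, neg_neg, Multiset.coe_card]
    rfl
  have h1 : ε ∘ₗ φ = (ε ∘ₗ φ ∘ₗ b) ∘ₗ h + ((ε ∘ₗ φ) ∘ₗ h) ∘ₗ b := by
    conv_lhs => rw [← LinearMap.comp_id (ε ∘ₗ φ), ← hbh]
    rw [LinearMap.comp_add]
    rfl
  rw [h1, map_add, LinearMap.trace_comp_comm' b ((ε ∘ₗ φ) ∘ₗ h)]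
  have h3 : b ∘ₗ (ε ∘ₗ φ) ∘ₗ h = - ((ε ∘ₗ φ ∘ₗ b) ∘ₗ h) := by
    rw [← LinearMap.comp_assoc, ← LinearMap.comp_assoc, hεb, ← hφ]
    rfl
  rw [h3, map_neg, add_neg_cancel]

end Alternating

/-! ### Weights on the subsets of a vector space over a prime field -/

section Weights

open scoped Pointwise

variable {p : ℕ} [Fact p.Prime] {G : Type*} [AddCommGroup G] [Module (ZMod p) G] [Fintype G]
  [DecidableEq G]

lemma exists_functional_stabilizer (R : Finset G) :
    ∃ χ : G →ₗ[ZMod p] ZMod p, (∀ a : G, a +ᵥ R = R → χ a = 0) ∧ (R = ∅ → χ = 0) ∧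
      (R.Nonempty → R ≠ Finset.univ → χ ≠ 0) := by
  by_cases h : R.Nonempty ∧ R ≠ Finset.univ
  · set N : Submodule (ZMod p) G := AddSubgroup.toZModSubmodule p (AddAction.stabilizer G R)
    have hN : N < ⊤ := by
      rw [lt_top_iff_ne_top]
      intro hN
      refine h.2 (Finset.eq_univ_iff_forall.2 fun b => ?_)
      obtain ⟨a, ha⟩ := h.1
      have hb : b - a ∈ N := hN ▸ Submodule.mem_top
      have hb' : (b - a) +ᵥ R = R := by simpa [N] using hb
      rw [← hb']
      exact Finset.mem_vadd_finset.2 ⟨a, ha, by simp⟩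
    obtain ⟨χ, hχ, hle⟩ := Submodule.exists_le_ker_of_lt_top N hN
    refine ⟨χ, fun a ha => ?_, fun h0 => absurd h0 h.1.ne_empty, fun _ _ => hχ⟩
    have : a ∈ N := by simpa [N] using ha
    simpa using hle this
  · exact ⟨0, by simp, by simp, fun h1 h2 => absurd ⟨h1, h2⟩ h⟩

/-- Functions on the subsets of `G`, equivariant along translation orbits with respect to an
invariant family of linear functionals that vanishes only for trivial subsets. -/
lemma exists_weights :
    ∃ (χ : Finset G → (G →ₗ[ZMod p] ZMod p)) (y : Finset G → ZMod p),
      (∀ (a : G) S, χ (a +ᵥ S) = χ S) ∧ (∀ (a : G) S, y (a +ᵥ S) = y S + χ S a) ∧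
      χ ∅ = 0 ∧ ∀ S, S.Nonempty → S ≠ Finset.univ → χ S ≠ 0 := by
  choose χ₀ h1 h2 h3 using exists_functional_stabilizer (p := p) (G := G)
  set r : Finset G → Finset G :=
    fun S => (Quotient.mk (AddAction.orbitRel G (Finset G)) S).out with hr
  have hex : ∀ S, ∃ a : G, a +ᵥ r S = S := by
    intro S
    have : (AddAction.orbitRel G (Finset G)) (r S) S := Quotient.mk_out S
    have := (AddAction.orbitRel G (Finset G)).symm this
    exact this
  choose s hs using hex
  have hinv : ∀ (a : G) S, r (a +ᵥ S) = r S := by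
    intro a S
    simp only [hr]
    congr 1
    exact Quotient.sound ⟨a, rfl⟩
  refine ⟨fun S => χ₀ (r S), fun S => χ₀ (r S) (s S), fun a S => by simp only [hinv], ?_, ?_, ?_⟩
  · intro a S
    have : (s (a +ᵥ S) - (s S + a)) +ᵥ r S = r S := by
      have h := hs (a +ᵥ S)
      rw [hinv] at h
      rw [sub_eq_neg_add, add_vadd, h, vadd_vadd, neg_add_rev, add_comm (-a), neg_add_cancel_right]
      calc -s S +ᵥ S = -s S +ᵥ (s S +ᵥ r S) := by rw [hs]
        _ = r S := neg_vadd_vadd _ _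
    have := h1 _ _ this
    rw [map_sub, sub_eq_zero, map_add] at this
    simpa only [hinv] using this
  · refine h2 _ ?_
    have := hs ∅
    simpa using congrArg Finset.card this
  · intro S hS hS'
    refine h3 _ ?_ ?_
    · rw [← hs S] at hS
      simpa using hS
    · intro h
      apply hS'
      rw [← hs S, h]
      simp
end Weights

/-! ### The action of the group algebra -/

section Action

open scoped Pointwise

variable {K : Type*} [Field K] {G : Type*} [AddCommGroup G]

/-- Translations acting on chains. -/
noncomputable def translate (K : Type*) [Field K] (G : Type*) [AddCommGroup G] :
    Multiplicative G →* Module.End K (Chain K G) where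
  toFun a := mapChain K (fun x => a.toAdd + x)
  map_one' := by
    refine chain_hom_ext fun w => ?_
    simp
  map_mul' a b := by
    refine chain_hom_ext fun w => ?_
    simp [add_assoc]

/-- The action of the group algebra on chains. -/
noncomputable def act (K : Type*) [Field K] (G : Type*) [AddCommGroup G] :
    AddMonoidAlgebra K G →ₐ[K] Module.End K (Chain K G) :=
  AddMonoidAlgebra.lift K _ G (translate K G)

lemma act_single (a : G) (k : K) :
    act K G (AddMonoidAlgebra.single a k) = k • mapChain K (fun x => a + x) := by
  simp [act, translate]

/-- A submodule stable under translations is stable under the group algebra. -/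
lemma act_mem {M : Type*} [AddCommGroup M] [Module K M] (f : Chain K G →ₗ[K] M)
    (N : Submodule K M) (c : Chain K G) (h : ∀ a : G, f (mapChain K (fun x => a + x) c) ∈ N)
    (r : AddMonoidAlgebra K G) : f (act K G r c) ∈ N := by
  induction r using AddMonoidAlgebra.induction_linear with
  | zero => simp
  | add r s hr hs => simpa using add_mem hr hs
  | single a k => simpa [act_single] using N.smul_mem k (h a)

lemma act_altRel (r : AddMonoidAlgebra K G) : ∀ c ∈ altRel K G, act K G r c ∈ altRel K G :=
  fun c hc => act_mem LinearMap.id _ c (fun _ => altRel_mapChain _ c hc) r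

/-- The action of the group algebra on alternating chains. -/
noncomputable def altAct (r : AddMonoidAlgebra K G) : Module.End K (AltChain K G) :=
  altDesc (act K G r) (act_altRel r)

/-- A linear map commuting with translations commutes with the group algebra. -/
lemma comp_act_eq {f : Chain K G →ₗ[K] AltChain K G}
    (h : ∀ a : G, f ∘ₗ mapChain K (fun x => a + x) =
      altAct (AddMonoidAlgebra.single a 1) ∘ₗ f) (r : AddMonoidAlgebra K G) :
    f ∘ₗ act K G r = altAct r ∘ₗ f := by
  have hadd : ∀ r s : AddMonoidAlgebra K G, altAct (r + s) = altAct r + altAct s := by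
    intro r s
    refine alt_hom_ext fun w => ?_
    simp [altAct, altDesc_altWord]
  have hsmul : ∀ (k : K) (r : AddMonoidAlgebra K G), altAct (k • r) = k • altAct r := by
    intro k r
    refine alt_hom_ext fun w => ?_
    simp [altAct, altDesc_altWord]
  induction r using AddMonoidAlgebra.induction_linear with
  | zero =>
    have : altAct (0 : AddMonoidAlgebra K G) = 0 := by simpa using hsmul 0 0
    simp [this]
  | add r s hr hs => rw [map_add, hadd, LinearMap.comp_add, LinearMap.add_comp, hr, hs]
  | single a k =>
    have : (AddMonoidAlgebra.single a k : AddMonoidAlgebra K G) =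
        k • AddMonoidAlgebra.single a 1 := by simp
    rw [this, map_smul, hsmul, LinearMap.comp_smul, LinearMap.smul_comp, act_single, one_smul, h]

lemma boundary_act (r : AddMonoidAlgebra K G) (c : Chain K G) :
    boundary K G (act K G r c) = act K G r (boundary K G c) := by
  induction r using AddMonoidAlgebra.induction_linear with
  | zero => simp
  | add r s hr hs => simp [hr, hs]
  | single a k => simp [act_single, mapChain_boundary]

end Action

/-! ### Derivation operators -/

section Derivation

open scoped Pointwise

variable {p : ℕ} {K : Type*} [Field K] {G : Type*} [AddCommGroup G]

lemma act_altRel_mkQ (r : AddMonoidAlgebra K G) (c : Chain K G) :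
    (altRel K G).mkQ (act K G r c) = altAct r ((altRel K G).mkQ c) := rfl

/-- Translation invariant diagonal operators commute with the group algebra. -/
lemma altDiag_altAct (c : Multiset G → K) (hc : ∀ (a : G) s, c (s.map (fun x => a + x)) = c s)
    (r : AddMonoidAlgebra K G) : altDiag c ∘ₗ altAct r = altAct r ∘ₗ altDiag c := by
  refine alt_hom_ext fun w => ?_
  rw [LinearMap.comp_apply, LinearMap.comp_apply, altDiag_altWord, map_smul, ← sub_eq_zero]
  refine act_mem ((altDiag c - c w • LinearMap.id) ∘ₗ (altRel K G).mkQ) ⊥ (word K w) (fun a => ?_) r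
  have := altDiag_altWord c (w.map fun x => a + x)
  rw [← Multiset.map_coe, hc] at this
  rw [mapChain_single]
  change altDiag c (altWord K _) - c w • altWord K _ = 0
  rw [this, sub_self]

variable [Fact p.Prime] [CharP K p] [Algebra (ZMod p) K] [Module (ZMod p) G]
  {ι : Type*} [Fintype ι]

instance : CharP (AddMonoidAlgebra K G) p :=
  charP_of_injective_algebraMap (algebraMap K (AddMonoidAlgebra K G)).injective p

/-- A fixed combination of differences of translations. -/
noncomputable def transDiff (g : ι → G) (α : ι → K) : AddMonoidAlgebra K G :=
  ∑ i, (AddMonoidAlgebra.single (g i) (α i) - AddMonoidAlgebra.single 0 (α i))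

/-- The commutator of `transDiff` with the twist by a functional. -/
noncomputable def transWeight (g : ι → G) (α : ι → K) (χ : G →ₗ[ZMod p] ZMod p) :
    AddMonoidAlgebra K G :=
  ∑ i, AddMonoidAlgebra.single (g i) (α i * algebraMap (ZMod p) K (χ (g i)))

omit [Fintype ι] [CharP K p] [Algebra (ZMod p) K] in
lemma prime_nsmul_eq_zero (a : G) : p • a = 0 := by
  rw [← Nat.cast_smul_eq_nsmul (ZMod p), CharP.cast_eq_zero, zero_smul]

omit [Algebra (ZMod p) K] in
lemma transDiff_pow (g : ι → G) (α : ι → K) : transDiff g α ^ p = 0 := by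
  rw [transDiff, sum_pow_char]
  refine Finset.sum_eq_zero fun i _ => ?_
  rw [sub_pow_char, AddMonoidAlgebra.single_pow, AddMonoidAlgebra.single_pow,
    prime_nsmul_eq_zero, prime_nsmul_eq_zero, sub_self]

lemma isUnit_transWeight (g : ι → G) (α : ι → K) (χ : G →ₗ[ZMod p] ZMod p)
    (h : ∑ i, α i * algebraMap (ZMod p) K (χ (g i)) ≠ 0) : IsUnit (transWeight g α χ) := by
  have hp : p ≠ 0 := (Fact.out : p.Prime).ne_zero
  rw [← isUnit_pow_iff hp, transWeight, sum_pow_char]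
  have : ∑ i, (AddMonoidAlgebra.single (g i) (α i * algebraMap (ZMod p) K (χ (g i)))) ^ p =
      algebraMap K (AddMonoidAlgebra K G) ((∑ i, α i * algebraMap (ZMod p) K (χ (g i))) ^ p) := by
    rw [sum_pow_char, map_sum]
    refine Finset.sum_congr rfl fun i _ => ?_
    rw [AddMonoidAlgebra.single_pow, prime_nsmul_eq_zero]
    rfl
  rw [this]
  exact (isUnit_iff_ne_zero.2 (pow_ne_zero _ h)).map _

/-- An operator whose commutator with a nilpotent invariant operator is the projection to the
span of simplices on nontrivial sets of vertices. -/
lemma exists_derivation [Fintype G] [DecidableEq G] (g : ι → G) (α : ι → K)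
    (hind : ∀ χ : G →ₗ[ZMod p] ZMod p, χ ≠ 0 → ∑ i, α i * algebraMap (ZMod p) K (χ (g i)) ≠ 0) :
    ∃ (t : AddMonoidAlgebra K G) (Y M : Module.End K (AltChain K G)),
      t ^ p = 0 ∧ altAct t * Y - Y * altAct t = M ∧ M * M = M ∧ Y * M = M * Y ∧
      altAct t * M = M * altAct t ∧ M (altWord K []) = 0 ∧
      (∀ w, M (altWord K w) = altWord K w ∨ M (altWord K w) = 0) ∧
      ∀ w : List G, w.Nodup → w ≠ [] → w.length < Fintype.card G →
        M (altWord K w) = altWord K w := by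
  classical
  obtain ⟨χ, y, h1, h2, h3, h4⟩ := exists_weights (p := p) (G := G)
  have hmap : ∀ (a : G) (s : Multiset G), (s.map (fun x => a + x)).toFinset = a +ᵥ s.toFinset := by
    intro a s
    ext; simp [Finset.mem_vadd_finset]
  set v : Finset G → AddMonoidAlgebra K G := fun S => -Ring.inverse (transWeight g α (χ S)) with hv
  set O : Multiset G → Module.End K (Chain K G) := fun s =>
    algebraMap (ZMod p) K (y s.toFinset) • act K G (v s.toFinset) with hO
  set m : Multiset G → K := fun s => if χ s.toFinset = 0 then 0 else 1 with hm
  set Y : Module.End K (AltChain K G) := altDesc (twist O)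
    (altRel_twist _ fun s c hc => Submodule.smul_mem _ _ (act_altRel _ _ hc)) with hY
  set t := transDiff g α with ht
  have hYw : ∀ w, Y (altWord K w) = algebraMap (ZMod p) K (y w.toFinset) •
      altAct (v w.toFinset) (altWord K w) := by
    intro w
    rw [hY, altDesc_altWord, twist_word]
    rfl
  have hminv : ∀ (a : G) s, m (s.map (fun x => a + x)) = m s := by
    intro a s
    simp only [hm, hmap, h1]
  have hmt := altDiag_altAct m hminv
  refine ⟨t, Y, altDiag m, transDiff_pow g α, ?_, ?_, ?_, ?_, ?_, ?_, ?_⟩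
  · refine alt_hom_ext fun w => ?_
    set S := w.toFinset with hS
    have hu : act K G (v S) (act K G (transWeight g α (χ S)) (word K w)) =
        - (m w • word K w) := by
      rw [← Module.End.mul_apply, ← map_mul]
      by_cases h0 : χ S = 0
      · have hz : transWeight g α (χ S) = 0 := by simp [h0, transWeight]
        have hm0 : m w = 0 := if_pos h0
        simp [hz, hm0]
      · have hm0 : m w = 1 := if_neg h0
        rw [hv]
        simp only
        rw [neg_mul, Ring.inverse_mul_cancel _ (isUnit_transWeight g α _ (hind _ h0)), hm0]
        simp
    have htw : ∀ a : G, twist O (word K (w.map fun x => a + x)) =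
        (algebraMap (ZMod p) K (y S) + algebraMap (ZMod p) K (χ S a)) •
          act K G (v S) (word K (w.map fun x => a + x)) := by
      intro a
      have hv1 : v (a +ᵥ S) = v S := by simp only [hv, h1]
      rw [twist_word, ← Multiset.map_coe, hO]
      simp only [hmap]
      change algebraMap (ZMod p) K (y (a +ᵥ S)) • act K G (v (a +ᵥ S)) _ = _
      rw [h2, hv1, map_add]
    have htw0 : twist O (word K w) = algebraMap (ZMod p) K (y S) • act K G (v S) (word K w) := by
      rw [twist_word]; rfl
    have hcomm : twist O (act K G t (word K w)) =
        algebraMap (ZMod p) K (y S) • act K G (v S) (act K G t (word K w)) +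
          act K G (v S) (act K G (transWeight g α (χ S)) (word K w)) := by
      have e1 : act K G t (word K w) =
          ∑ i, α i • (word K (w.map fun x => g i + x) - word K w) := by
        simp only [ht, transDiff, map_sum, map_sub, act_single, LinearMap.sum_apply,
          LinearMap.sub_apply, LinearMap.smul_apply, mapChain_single, zero_add, smul_sub,
          List.map_id']
      have e2 : act K G (transWeight g α (χ S)) (word K w) =
          ∑ i, (α i * algebraMap (ZMod p) K (χ S (g i))) • word K (w.map fun x => g i + x) := by
        simp only [transWeight, map_sum, act_single, LinearMap.sum_apply,
          LinearMap.smul_apply, mapChain_single]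
      rw [e1, e2]
      simp only [map_sum, map_smul, map_sub, htw, htw0, Finset.smul_sum]
      rw [← Finset.sum_add_distrib]
      refine Finset.sum_congr rfl fun i _ => ?_
      module
    have hcomm2 : act K G (v S) (act K G t (word K w)) = act K G t (act K G (v S) (word K w)) := by
      rw [← Module.End.mul_apply, ← Module.End.mul_apply, ← map_mul, ← map_mul, mul_comm]
    have key : act K G t (twist O (word K w)) - twist O (act K G t (word K w)) =
        m w • word K w := by
      rw [hcomm, htw0, hu, map_smul, hcomm2]
      abel
    rw [altDiag_altWord]
    exact congrArg (altRel K G).mkQ key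
  · refine alt_hom_ext fun w => ?_
    rw [Module.End.mul_apply, altDiag_altWord, map_smul, altDiag_altWord, smul_smul]
    congr 1
    simp only [hm]
    split_ifs <;> simp
  · refine alt_hom_ext fun w => ?_
    rw [Module.End.mul_apply, Module.End.mul_apply, altDiag_altWord, map_smul, hYw, map_smul,
      ← LinearMap.comp_apply, hmt, LinearMap.comp_apply, altDiag_altWord, map_smul, smul_comm]
  · exact (hmt t).symm
  · rw [altDiag_altWord]
    simp [hm, h3]
  · intro w
    rw [altDiag_altWord]
    by_cases h0 : χ w.toFinset = 0
    · right
      simp [hm, h0]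
    · left
      simp [hm, h0]
  · intro w hw hne hl
    rw [altDiag_altWord]
    have : χ w.toFinset ≠ 0 := by
      refine h4 _ (by simpa [Finset.nonempty_iff_ne_empty] using hne) fun h => ?_
      rw [← List.toFinset_card_of_nodup hw, h] at hl
      simp at hl
    simp [hm, this]

end Derivation

section Correction

variable {p : ℕ} [Fact p.Prime] {K : Type*} [Field K] [CharP K p] {V W : Type*} [AddCommGroup V]
  [Module K V] [AddCommGroup W] [Module K W]

/-- The commutator with a pair of operators. -/
noncomputable def commutator (tV : Module.End K V) (tW : Module.End K W) :
    Module.End K (V →ₗ[K] W) where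
  toFun s := tW ∘ₗ s - s ∘ₗ tV
  map_add' s s' := by rw [LinearMap.comp_add, LinearMap.add_comp]; abel
  map_smul' k s := by simp [LinearMap.comp_smul, LinearMap.smul_comp, smul_sub]

lemma commutator_pow_prime {tV : Module.End K V} {tW : Module.End K W} (hV : tV ^ p = 0)
    (hW : tW ^ p = 0) : commutator tV tW ^ p = 0 := by
  have hp : p.Prime := Fact.out
  set l : Module.End K (V →ₗ[K] W) :=
    { toFun := fun s => tW ∘ₗ s
      map_add' := fun s s' => LinearMap.comp_add _ _ _
      map_smul' := fun k s => LinearMap.comp_smul _ _ _ } with hl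
  set r : Module.End K (V →ₗ[K] W) :=
    { toFun := fun s => s ∘ₗ tV
      map_add' := fun s s' => LinearMap.add_comp _ _ _
      map_smul' := fun k s => LinearMap.smul_comp _ _ _ } with hr
  have hlp : ∀ m s, (l ^ m) s = (tW ^ m) ∘ₗ s := by
    intro m
    induction m with
    | zero => intro s; rfl
    | succ m ih => intro s; rw [pow_succ, Module.End.mul_apply, ih, pow_succ]; rfl
  have hrp : ∀ m s, (r ^ m) s = s ∘ₗ (tV ^ m) := by
    intro m
    induction m with
    | zero => intro s; rfl
    | succ m ih => intro s; rw [pow_succ, Module.End.mul_apply, ih, pow_succ']; rfl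
  have hlp0 : l ^ p = 0 := LinearMap.ext fun s => by rw [hlp, hW]; rfl
  have hrp0 : r ^ p = 0 := LinearMap.ext fun s => by rw [hrp, hV]; simp
  have hcomm : Commute l (-r) := Commute.neg_right (show l * r = r * l from LinearMap.ext fun s => rfl)
  obtain ⟨x, hx⟩ := hcomm.exists_add_pow_prime_eq hp
  have hD : commutator tV tW = l + -r := LinearMap.ext fun s => sub_eq_add_neg _ _
  have hp0 : (p : Module.End K (V →ₗ[K] W)) = 0 := by
    refine LinearMap.ext fun s => ?_
    rw [Module.End.natCast_apply, ← Nat.cast_smul_eq_nsmul K, CharP.cast_eq_zero]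
    simp
  have hnr : (-r) ^ p = 0 := by
    have := neg_pow r p
    rw [hrp0, mul_zero] at this
    exact this
  rw [hD, hx, hlp0, hnr, hp0]
  simp

lemma commutator_pow_mul {t Y M : Module.End K V} (h : t * Y - Y * t = M) (hMM : M * M = M)
    (hYM : Y * M = M * Y) (htM : t * M = M * t) (m : ℕ) :
    t * (Y ^ (m + 1) * M) - Y ^ (m + 1) * M * t = ((m + 1 : ℕ) : K) • (Y ^ m * M) := by
  have hY : t * Y = Y * t + M := by rw [← h]; abel
  induction m with
  | zero =>
    rw [zero_add, pow_one, pow_zero, Nat.cast_one, one_smul, one_mul, mul_assoc, ← htM,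
      ← mul_assoc, ← mul_assoc, hY, add_mul, hMM]
    abel
  | succ m ih =>
    have hc : Commute (Y ^ (m + 1)) M := Commute.pow_left hYM _
    have e : t * (Y ^ (m + 1) * M) = Y ^ (m + 1) * M * t + ((m + 1 : ℕ) : K) • (Y ^ m * M) := by
      rw [← ih]; abel
    have e2 : M * (Y ^ (m + 1) * M) = Y ^ (m + 1) * M := by
      rw [← mul_assoc, ← hc.eq, mul_assoc, hMM]
    calc t * (Y ^ (m + 1 + 1) * M) - Y ^ (m + 1 + 1) * M * t
        = (t * Y) * (Y ^ (m + 1) * M) - Y * (Y ^ (m + 1) * M * t) := by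
          rw [pow_succ' Y (m + 1)]; simp only [mul_assoc]
      _ = Y * (t * (Y ^ (m + 1) * M)) + M * (Y ^ (m + 1) * M) - Y * (Y ^ (m + 1) * M * t) := by
          rw [hY, add_mul, mul_assoc]
      _ = ((m + 1 + 1 : ℕ) : K) • (Y ^ (m + 1) * M) := by
          rw [e, e2, mul_add, mul_smul_comm, ← mul_assoc Y (Y ^ m), ← pow_succ',
            Nat.cast_succ (m + 1), add_smul, one_smul]
          abel

/-- A linear solution of `b ∘ s = f` can be made invariant where a derivation exists. -/
lemma exists_invariant_lift {tV Y M : Module.End K V} {tW : Module.End K W} (hV : tV ^ p = 0)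
    (hW : tW ^ p = 0) (h : tV * Y - Y * tV = M) (hMM : M * M = M) (hYM : Y * M = M * Y)
    (htM : tV * M = M * tV) {b : Module.End K W} (hb : b * tW = tW * b) {f s : V →ₗ[K] W}
    (hf : tW ∘ₗ f = f ∘ₗ tV) (hs : b ∘ₗ s = f) (N : Submodule K W) (hN : ∀ x ∈ N, tW x ∈ N)
    (hsN : ∀ x, s x ∈ N) :
    ∃ s' : V →ₗ[K] W, tW ∘ₗ s' = s' ∘ₗ tV ∧ b ∘ₗ s' = f ∘ₗ M ∧ ∀ x, s' x ∈ N := by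
  have hp : p.Prime := Fact.out
  set D := commutator tV tW with hD
  have hD0 : D ^ p = 0 := commutator_pow_prime hV hW
  have hDb : ∀ (m : ℕ) (x : V →ₗ[K] W), b ∘ₗ (D ^ m) x = (D ^ m) (b ∘ₗ x) := by
    intro m
    induction m with
    | zero => intro x; rfl
    | succ m ih =>
      intro x
      rw [pow_succ, Module.End.mul_apply, Module.End.mul_apply, ih]
      congr 1
      change b ∘ₗ (tW ∘ₗ x - x ∘ₗ tV) = tW ∘ₗ (b ∘ₗ x) - (b ∘ₗ x) ∘ₗ tV
      rw [LinearMap.comp_sub, ← LinearMap.comp_assoc, ← LinearMap.comp_assoc,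
        ← LinearMap.comp_assoc, ← Module.End.mul_eq_comp, ← Module.End.mul_eq_comp, hb]
  have hDN : ∀ (m : ℕ) (x : V →ₗ[K] W), (∀ v, x v ∈ N) → ∀ v, (D ^ m) x v ∈ N := by
    intro m
    induction m with
    | zero => intro x hx; exact hx
    | succ m ih =>
      intro x hx
      rw [pow_succ, Module.End.mul_apply]
      exact ih _ fun v => sub_mem (hN _ (hx v)) (hx _)
  have hDf : ∀ m : ℕ, (D ^ m) (f ∘ₗ (Y ^ m * M)) = (m.factorial : K) • (f ∘ₗ M) := by
    intro m
    induction m with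
    | zero => simp
    | succ m ih =>
      rw [pow_succ, Module.End.mul_apply]
      have : D (f ∘ₗ (Y ^ (m + 1) * M)) = ((m + 1 : ℕ) : K) • (f ∘ₗ (Y ^ m * M)) := by
        change tW ∘ₗ (f ∘ₗ _) - (f ∘ₗ _) ∘ₗ tV = _
        rw [← LinearMap.comp_assoc, hf, LinearMap.comp_assoc, LinearMap.comp_assoc,
          ← LinearMap.comp_sub, ← LinearMap.comp_smul]
        congr 1
        exact commutator_pow_mul h hMM hYM htM m
      rw [this, map_smul, ih, smul_smul, Nat.factorial_succ, Nat.cast_mul]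
  have hfac : ((p - 1).factorial : K) ≠ 0 := by
    rw [Ne, CharP.cast_eq_zero_iff K p, hp.dvd_factorial]
    have := hp.pos
    omega
  refine ⟨((p - 1).factorial : K)⁻¹ • (D ^ (p - 1)) (s ∘ₗ (Y ^ (p - 1) * M)), ?_, ?_, ?_⟩
  · rw [LinearMap.comp_smul, LinearMap.smul_comp, ← sub_eq_zero, ← smul_sub]
    have : D ((D ^ (p - 1)) (s ∘ₗ (Y ^ (p - 1) * M))) = 0 := by
      rw [← Module.End.mul_apply, ← pow_succ', Nat.sub_add_cancel hp.one_le, hD0]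
      rfl
    rw [show _ ∘ₗ _ - _ ∘ₗ _ = D ((D ^ (p - 1)) (s ∘ₗ (Y ^ (p - 1) * M))) from rfl, this,
      smul_zero]
  · rw [LinearMap.comp_smul, hDb, ← LinearMap.comp_assoc, hs, hDf, smul_smul, inv_mul_cancel₀ hfac,
      one_smul]
  · intro x
    exact N.smul_mem _ (hDN _ (s ∘ₗ (Y ^ (p - 1) * M)) (fun v => hsN _) x)

end Correction

section Section

variable {p : ℕ} [Fact p.Prime] {K : Type*} [Field K] [CharP K p] [Algebra (ZMod p) K]
  {G : Type*} [AddCommGroup G] [Module (ZMod p) G] [Fintype G] [DecidableEq G]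
  {ι : Type*} [Fintype ι]

omit [Fintype G] [DecidableEq G] in
lemma act_nil_altAug (r : AddMonoidAlgebra K G) :
    ∃ e : K, act K G r (word K []) = e • word K [] ∧
      ∀ d, altAug K G (altAct r d) = e * altAug K G d := by
  induction r using AddMonoidAlgebra.induction_linear with
  | zero =>
    refine ⟨0, by simp, fun d => ?_⟩
    obtain ⟨c, rfl⟩ := (altRel K G).mkQ_surjective d
    rw [← act_altRel_mkQ]
    simp
  | add r s hr hs =>
    obtain ⟨e, h1, h2⟩ := hr
    obtain ⟨e', h1', h2'⟩ := hs
    refine ⟨e + e', by rw [map_add, LinearMap.add_apply, h1, h1', add_smul], fun d => ?_⟩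
    rw [add_mul, ← h2, ← h2', ← map_add]
    obtain ⟨c, rfl⟩ := (altRel K G).mkQ_surjective d
    rw [← act_altRel_mkQ, ← act_altRel_mkQ, ← act_altRel_mkQ, map_add, LinearMap.add_apply, map_add]
  | single a k =>
    refine ⟨k, by simp [act_single], fun d => ?_⟩
    have : altAug K G ∘ₗ altAct (AddMonoidAlgebra.single a k) = k • altAug K G := by
      refine alt_hom_ext fun w => ?_
      change altAug K G ((altRel K G).mkQ (act K G _ (word K w))) = _
      rw [act_single, LinearMap.smul_apply, mapChain_single, map_smul, map_smul]
      change k • altAug K G (altWord K _) = k • altAug K G (altWord K _)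
      rw [altAug_altWord, altAug_altWord]
      simp
    exact LinearMap.congr_fun this d

omit [Fintype G] [DecidableEq G] in
lemma altBoundary_altAct (r : AddMonoidAlgebra K G) :
    altBoundary K G ∘ₗ altAct r = altAct r ∘ₗ altBoundary K G := by
  refine alt_hom_ext fun w => ?_
  exact congrArg (altRel K G).mkQ (boundary_act r (word K w))

omit [DecidableEq G] in
lemma act_mem_injWords (r : AddMonoidAlgebra K G) (l : ℕ) {c : Chain K G}
    (hc : c ∈ Finsupp.supported K K (injWords Finset.univ l)) :
    act K G r c ∈ Finsupp.supported K K (injWords Finset.univ l) := by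
  refine act_mem LinearMap.id _ c (fun a => ?_) r
  refine map_mem_of_supported (mapChain K _) _ _ (fun w hw => ?_) hc
  rw [mapChain_single]
  refine word_mem_supported ⟨hw.1.map (add_right_injective a), by simp, by simpa using hw.2.2⟩

omit [Fintype G] [DecidableEq G] in
lemma altDiag_card_altAct (c : ℕ → K) (r : AddMonoidAlgebra K G) :
    altDiag (fun s => c (Multiset.card s)) ∘ₗ altAct r =
      altAct r ∘ₗ altDiag fun s => c (Multiset.card s) :=
  altDiag_altAct _ (fun a s => by simp) r

omit [AddCommGroup G] in
lemma exists_lift_of_range {V : Type*} [AddCommGroup V] [Module K V] {l : ℕ}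
    (hl : l < Fintype.card G) (f : V →ₗ[K] Chain K G)
    (h1 : ∀ x, f x ∈ Finsupp.supported K K (injWords Finset.univ l))
    (h2 : ∀ x, boundary K G (f x) = 0) :
    ∃ s : V →ₗ[K] Chain K G, boundary K G ∘ₗ s = f ∧
      ∀ x, s x ∈ Finsupp.supported K K (injWords Finset.univ (l + 1)) := by
  set N := Finsupp.supported K K (injWords (Finset.univ : Finset G) (l + 1))
  set b := boundary K G ∘ₗ N.subtype with hb
  have hr : ∀ x, f x ∈ LinearMap.range b := by
    intro x
    obtain ⟨c, hc, h⟩ := exists_boundary_eq_of_cycle Finset.univ l hl (f x) (h1 x) (h2 x)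
    exact ⟨⟨c, hc⟩, h⟩
  obtain ⟨s, hs⟩ := Module.projective_lifting_property b.rangeRestrict
    (f.codRestrict _ hr) b.surjective_rangeRestrict
  refine ⟨N.subtype ∘ₗ s, ?_, fun x => (s x).2⟩
  refine LinearMap.ext fun x => ?_
  exact congrArg Subtype.val (LinearMap.congr_fun hs x)

omit [Algebra (ZMod p) K] [Module (ZMod p) G] in
set_option maxHeartbeats 800000 in
/-- Equivariant sections of the projection from words to alternating chains, as chain maps in
degrees below the top one. -/
lemma exists_section {t : AddMonoidAlgebra K G} {Y M : Module.End K (AltChain K G)}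
    (ht : t ^ p = 0) (h : altAct t * Y - Y * altAct t = M) (hMM : M * M = M) (hYM : Y * M = M * Y)
    (htM : altAct t * M = M * altAct t)
    (hM01 : ∀ w, M (altWord K w) = altWord K w ∨ M (altWord K w) = 0)
    (hM : ∀ w : List G, w.Nodup → w ≠ [] → w.length < Fintype.card G →
        M (altWord K w) = altWord K w) (m : ℕ) (hm : m < Fintype.card G) :
    ∃ Ψ : AltChain K G →ₗ[K] Chain K G, act K G t ∘ₗ Ψ = Ψ ∘ₗ altAct t ∧
      Ψ (altWord K []) = word K [] ∧
      ∀ w : List G, w.length ≤ m →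
        Ψ (altWord K w) ∈ Finsupp.supported K K (injWords Finset.univ w.length) ∧
        boundary K G (Ψ (altWord K w)) = Ψ (altBoundary K G (altWord K w)) := by
  have hV : (altAct t : Module.End K (AltChain K G)) ^ p = 0 := by
    have hpow : ∀ n : ℕ, ∀ c : Chain K G, ((altAct t : Module.End K (AltChain K G)) ^ n)
        ((altRel K G).mkQ c) = (altRel K G).mkQ (act K G (t ^ n) c) := by
      intro n
      induction n with
      | zero => simp
      | succ n ih =>
        intro c
        rw [pow_succ, Module.End.mul_apply, ← act_altRel_mkQ, ih, pow_succ, map_mul]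
        rfl
    refine alt_hom_ext fun w => ?_
    rw [altWord, hpow, ht]
    simp
  have hW : act K G t ^ p = 0 := by rw [← map_pow, ht, map_zero]
  induction m with
  | zero =>
    obtain ⟨e, h1, h2⟩ := act_nil_altAug t
    refine ⟨(altAug K G).smulRight (word K []), ?_, ?_, ?_⟩
    · refine LinearMap.ext fun d => ?_
      simp only [LinearMap.comp_apply, LinearMap.smulRight_apply, map_smul, h1, h2, smul_smul]
      rw [mul_comm]
    · simp [altAug_altWord]
    · intro w hw
      obtain rfl : w = [] := by simpa using hw
      have h0 : altBoundary K G (altWord K []) = 0 := by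
        rw [altWord, altBoundary_mkQ, boundary_nil, map_zero]
      rw [h0, map_zero, LinearMap.smulRight_apply, map_smul, boundary_nil, smul_zero]
      refine ⟨?_, rfl⟩
      exact Submodule.smul_mem _ _ (word_mem_supported ⟨by simp, by simp, rfl⟩)
  | succ m ih =>
    obtain ⟨Ψ, hΨt, hΨ0, hΨ⟩ := ih (by omega)
    set Ple := altDiag (K := K) (α := G) fun s => if Multiset.card s ≤ m then 1 else 0 with hPle
    set Peq := altDiag (K := K) (α := G) fun s => if Multiset.card s = m + 1 then 1 else 0 with hPeq
    have hPlew : ∀ w : List G, Ple (altWord K w) = if w.length ≤ m then altWord K w else 0 := by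
      intro w
      rw [hPle, altDiag_altWord]
      split_ifs <;> simp_all
    have hPeqw : ∀ w : List G, Peq (altWord K w) = if w.length = m + 1 then altWord K w else 0 := by
      intro w
      rw [hPeq, altDiag_altWord]
      split_ifs <;> simp_all
    have hPlet : Ple ∘ₗ altAct t = altAct t ∘ₗ Ple :=
      altDiag_card_altAct (fun n => if n ≤ m then 1 else 0) t
    have hPeqt : Peq ∘ₗ altAct t = altAct t ∘ₗ Peq :=
      altDiag_card_altAct (fun n => if n = m + 1 then 1 else 0) t
    set f := Ψ ∘ₗ altBoundary K G ∘ₗ Peq with hf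
    have hfw : ∀ w : List G, f (altWord K w) =
        if w.length = m + 1 then Ψ ((altRel K G).mkQ (boundary K G (word K w))) else 0 := by
      intro w
      simp only [hf, LinearMap.comp_apply, hPeqw]
      split_ifs
      · rfl
      · simp
    have hsupp : ∀ w : List G, w.length = m + 1 →
        boundary K G (word K w) ∈ Finsupp.supported K K {v : List G | v.length = m} := by
      intro w hw
      refine Finsupp.supported_mono ?_ (boundary_word_mem w)
      rintro v ⟨-, hv⟩
      simp only [Set.mem_ofPred_eq]
      omega
    have hft : act K G t ∘ₗ f = f ∘ₗ altAct t := by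
      rw [hf, ← LinearMap.comp_assoc, hΨt, LinearMap.comp_assoc, LinearMap.comp_assoc,
        LinearMap.comp_assoc, hPeqt, ← LinearMap.comp_assoc _ _ (altAct t), ← altBoundary_altAct,
        LinearMap.comp_assoc]
    have hfrange : ∀ x, f x ∈ Finsupp.supported K K (injWords Finset.univ m) := by
      intro x
      obtain ⟨c, rfl⟩ := (altRel K G).mkQ_surjective x
      refine map_mem_of_supported (f ∘ₗ (altRel K G).mkQ) Set.univ _ (fun w _ => ?_) (by simp)
      change f (altWord K w) ∈ _
      rw [hfw]
      split_ifs with hw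
      · refine map_mem_of_supported (Ψ ∘ₗ (altRel K G).mkQ) _ _ (fun v hv => ?_) (hsupp w hw)
        have := (hΨ v hv.le).1
        rwa [show v.length = m from hv] at this
      · exact zero_mem _
    have hfb : ∀ x, boundary K G (f x) = 0 := by
      intro x
      have : boundary K G ∘ₗ f = 0 := by
        refine alt_hom_ext fun w => ?_
        rw [LinearMap.comp_apply, hfw]
        split_ifs with hw
        · have := eq_of_supported (boundary K G ∘ₗ Ψ ∘ₗ (altRel K G).mkQ)
            (Ψ ∘ₗ altBoundary K G ∘ₗ (altRel K G).mkQ) _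
            (fun v (hv : v.length = m) => (hΨ v hv.le).2) (hsupp w hw)
          refine this.trans ?_
          simp only [LinearMap.comp_apply]
          rw [altBoundary_mkQ, boundary_boundary, map_zero, map_zero]
          rfl
        · simp
      exact LinearMap.congr_fun this x
    obtain ⟨s, hs, hsN⟩ := exists_lift_of_range (by omega) f hfrange hfb
    obtain ⟨s', hs't, hs'b, hs'N⟩ := exists_invariant_lift hV hW h hMM hYM htM
      (b := boundary K G) (LinearMap.ext fun c => boundary_act t c) hft hs _
      (fun x hx => act_mem_injWords t (m + 1) hx) hsN
    have hfM : f ∘ₗ M = f := by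
      refine alt_hom_ext fun w => ?_
      by_cases hw : w.Nodup
      · by_cases hl : w.length = m + 1
        · rw [LinearMap.comp_apply, hM w hw (by rintro rfl; simp at hl) (by omega)]
        · have h0 : f (altWord K w) = 0 := by rw [hfw, if_neg hl]
          rcases hM01 w with h1 | h1 <;> rw [LinearMap.comp_apply, h1, h0]
          simp
      · rw [altWord_eq_zero hw]
        simp
    refine ⟨Ψ ∘ₗ Ple + s' ∘ₗ Peq, ?_, ?_, ?_⟩
    · rw [LinearMap.comp_add, LinearMap.add_comp, ← LinearMap.comp_assoc, hΨt,
        ← LinearMap.comp_assoc, hs't, LinearMap.comp_assoc, LinearMap.comp_assoc,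
        LinearMap.comp_assoc, LinearMap.comp_assoc, hPlet, hPeqt]
    · simp [hPlew, hPeqw, hΨ0]
    · intro w hw
      have hbd : (Ψ ∘ₗ Ple + s' ∘ₗ Peq) (altBoundary K G (altWord K w)) =
          Ψ (altBoundary K G (altWord K w)) := by
        refine eq_of_supported ((Ψ ∘ₗ Ple + s' ∘ₗ Peq) ∘ₗ (altRel K G).mkQ)
          (Ψ ∘ₗ (altRel K G).mkQ) _ (fun v hv => ?_) (boundary_word_mem w)
        have h1 : v.length ≤ m := by have := hv.2; omega
        change Ψ (Ple (altWord K v)) + s' (Peq (altWord K v)) = Ψ (altWord K v)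
        rw [hPlew, hPeqw, if_pos h1, if_neg (by omega), map_zero, add_zero]
      rw [hbd, LinearMap.add_apply, LinearMap.comp_apply, LinearMap.comp_apply, hPlew, hPeqw]
      rcases Nat.lt_or_ge m w.length with h1 | h1
      · have h2 : w.length = m + 1 := by omega
        rw [if_neg (by omega), if_pos h2, map_zero Ψ, zero_add]
        refine ⟨h2 ▸ hs'N _, ?_⟩
        rw [← LinearMap.comp_apply, hs'b, hfM, hfw, if_pos h2]
        rfl
      · have h2 : ¬ w.length = m + 1 := by omega
        rw [if_pos h1, if_neg h2, map_zero, add_zero]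
        exact hΨ w h1

/-- An equivariant chain map from words to alternating chains is nonzero in top degree. -/
theorem exists_top_ne_zero (g : ι → G) (α : ι → K)
    (hind : ∀ χ : G →ₗ[ZMod p] ZMod p, χ ≠ 0 → ∑ i, α i * algebraMap (ZMod p) K (χ (g i)) ≠ 0)
    (Φ : Chain K G →ₗ[K] AltChain K G) (h0 : Φ (word K []) = altWord K [])
    (ht : ∀ a : G, Φ ∘ₗ mapChain K (fun x => a + x) = altAct (AddMonoidAlgebra.single a 1) ∘ₗ Φ)
    (hb : ∀ w : List G, w.Nodup → altBoundary K G (Φ (word K w)) = Φ (boundary K G (word K w))) :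
    ∃ w : List G, w.Nodup ∧ w.length = Fintype.card G ∧ Φ (word K w) ≠ 0 := by
  by_contra! hcon
  obtain ⟨t, Y, M, htp, hM, hMM, hYM, htM, hM0, hM01, hMw⟩ := exists_derivation g α hind
  have hq : 0 < Fintype.card G := Fintype.card_pos
  obtain ⟨Ψ, hΨt, hΨ0, hΨ⟩ := exists_section htp hM hMM hYM htM hM01 hMw
    (Fintype.card G - 1) (by omega)
  set P := altDiag (K := K) (α := G)
    fun s => if Multiset.card s ≤ Fintype.card G - 1 then 1 else 0 with hP
  have hPw : ∀ w : List G, P (altWord K w) =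
      if w.length ≤ Fintype.card G - 1 then altWord K w else 0 := by
    intro w
    rw [hP, altDiag_altWord]
    split_ifs <;> simp_all
  have hPt : P ∘ₗ altAct t = altAct t ∘ₗ P :=
    altDiag_card_altAct (fun n => if n ≤ Fintype.card G - 1 then 1 else 0) t
  have hbinj : ∀ l, ∀ c ∈ Finsupp.supported K K (injWords (Finset.univ : Finset G) l),
      altBoundary K G (Φ c) = Φ (boundary K G c) := fun l c hc =>
    eq_of_supported (altBoundary K G ∘ₗ Φ) (Φ ∘ₗ boundary K G) _ (fun w hw => hb w hw.1) hc
  set φ := Φ ∘ₗ Ψ ∘ₗ P with hφ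
  have hφt : altAct t ∘ₗ φ = φ ∘ₗ altAct t := by
    rw [hφ, ← LinearMap.comp_assoc, ← comp_act_eq ht, LinearMap.comp_assoc, LinearMap.comp_assoc,
      LinearMap.comp_assoc, hPt, ← LinearMap.comp_assoc _ _ (act K G t), hΨt,
      LinearMap.comp_assoc]
  have hφb : altBoundary K G ∘ₗ φ = φ ∘ₗ altBoundary K G := by
    refine alt_hom_ext fun w => ?_
    by_cases hw : w.Nodup
    swap
    · rw [altWord_eq_zero hw, map_zero, map_zero]
    have hl := hw.length_le_card
    have hbd : φ (altBoundary K G (altWord K w)) = Φ (Ψ (altBoundary K G (altWord K w))) := by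
      refine eq_of_supported (φ ∘ₗ (altRel K G).mkQ)
        ((Φ ∘ₗ Ψ) ∘ₗ (altRel K G).mkQ) _ (fun v hv => ?_) (boundary_word_mem w)
      have h1 : v.length ≤ Fintype.card G - 1 := by have := hv.2; omega
      change Φ (Ψ (P (altWord K v))) = Φ (Ψ (altWord K v))
      rw [hPw, if_pos h1]
    rw [LinearMap.comp_apply (altBoundary K G), LinearMap.comp_apply φ, hbd]
    change altBoundary K G (Φ (Ψ (P (altWord K w)))) = _
    rw [hPw]
    split_ifs with hlt
    · rw [hbinj _ _ (hΨ w hlt).1, (hΨ w hlt).2]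
    · rw [map_zero, map_zero, map_zero]
      have hlen : w.length = Fintype.card G - 1 + 1 := by omega
      have hz : Ψ (altBoundary K G (altWord K w)) ∈
          Finsupp.supported K K (injWords Finset.univ (Fintype.card G - 1)) := by
        refine map_mem_of_supported (Ψ ∘ₗ (altRel K G).mkQ) _ _ (fun v hv => ?_)
          (boundary_word_mem w)
        have h1 : v.length = Fintype.card G - 1 := by have := hv.2; omega
        have := (hΨ v h1.le).1
        rwa [h1] at this
      have hz0 : boundary K G (Ψ (altBoundary K G (altWord K w))) = 0 := by
        have := eq_of_supported (boundary K G ∘ₗ Ψ ∘ₗ (altRel K G).mkQ)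
          (Ψ ∘ₗ altBoundary K G ∘ₗ (altRel K G).mkQ) _
          (fun v hv => (hΨ v (by have := hv.2; omega)).2) (boundary_word_mem w)
        refine this.trans ?_
        simp only [LinearMap.comp_apply]
        rw [altBoundary_mkQ, boundary_boundary, map_zero, map_zero]
      obtain ⟨c, hc, hcz⟩ := exists_boundary_eq_of_cycle Finset.univ (Fintype.card G - 1)
        (by rw [Finset.card_univ]; omega) _ hz hz0
      rw [← hcz, ← hbinj _ _ hc]
      have : Φ c ∈ (⊥ : Submodule K (AltChain K G)) :=
        map_mem_of_supported Φ _ _ (fun v hv => hcon v hv.1 (by have := hv.2.2; omega)) hc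
      rw [(Submodule.mem_bot K).1 this, map_zero]
  have htr := supertrace_eq_zero φ hφb
  set ε := altDiag (K := K) (α := G) (fun s => (-1 : K) ^ Multiset.card s) with hε
  have hεt : ε ∘ₗ altAct t = altAct t ∘ₗ ε := altDiag_card_altAct (fun n => (-1) ^ n) t
  have htrM : LinearMap.trace K _ ((ε ∘ₗ φ) ∘ₗ M) = 0 := by
    have hc : altAct t * (ε ∘ₗ φ) = (ε ∘ₗ φ) * altAct t := by
      change altAct t ∘ₗ (ε ∘ₗ φ) = (ε ∘ₗ φ) ∘ₗ altAct t
      refine LinearMap.ext fun d => ?_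
      exact (LinearMap.congr_fun hεt (φ d)).symm.trans (congrArg ε (LinearMap.congr_fun hφt d))
    change LinearMap.trace K _ ((ε ∘ₗ φ) * M) = 0
    rw [← hM, mul_sub, map_sub, ← mul_assoc, ← mul_assoc, ← hc, mul_assoc,
      LinearMap.trace_mul_comm, sub_self]
  have hdiff : ε ∘ₗ φ - (ε ∘ₗ φ) ∘ₗ M = (altAug K G).smulRight (altWord K []) := by
    refine alt_hom_ext fun w => ?_
    rw [LinearMap.sub_apply, LinearMap.comp_apply (ε ∘ₗ φ), LinearMap.smulRight_apply,
      altAug_altWord]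
    by_cases hw : w = []
    · subst hw
      rw [hM0, map_zero, sub_zero, if_pos rfl, one_smul]
      change ε (Φ (Ψ (P _))) = _
      rw [hPw, if_pos (by simp), hΨ0, h0, hε, altDiag_altWord]
      simp
    · rw [if_neg hw, zero_smul]
      by_cases hn : w.Nodup
      · by_cases hl : w.length < Fintype.card G
        · rw [hMw w hn hw hl, sub_self]
        · have hφw : (ε ∘ₗ φ) (altWord K w) = 0 := by
            change ε (Φ (Ψ (P _))) = _
            rw [hPw, if_neg (by omega)]
            simp
          rcases hM01 w with h1 | h1
          · rw [h1, hφw, sub_self]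
          · rw [h1, hφw, map_zero, sub_self]
      · rw [altWord_eq_zero hn]
        simp
  have := congrArg (LinearMap.trace K _) hdiff
  rw [map_sub, htr, htrM, LinearMap.trace_smulRight, altAug_altWord] at this
  simp at this

end Section

/-! ### Barycentric subdivision -/

section Subdivision

variable {K : Type*} [Field K] {E : Type*} [NormedAddCommGroup E] [NormedSpace ℝ E]

/-- The barycenter of a list of points. -/
noncomputable def bary (l : List E) : E := (l.length : ℝ)⁻¹ • l.sum

/-- Barycentric subdivision of words of length at most `n`. -/
noncomputable def subdiv (K : Type*) [Field K] {E : Type*} [NormedAddCommGroup E]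
    [NormedSpace ℝ E] : ℕ → (Chain K E →ₗ[K] Chain K E)
  | 0 => LinearMap.id
  | n + 1 => Finsupp.linearCombination K fun l => match l with
    | [] => word K []
    | x :: l => consChain K (bary (x :: l)) (subdiv K n (boundary K E (word K (x :: l))))

lemma subdiv_nil (n : ℕ) : subdiv K n (word K ([] : List E)) = word K [] := by
  cases n <;> simp [subdiv]

lemma subdiv_succ (n : ℕ) {l : List E} (hl : l ≠ []) :
    subdiv K (n + 1) (word K l) =
      consChain K (bary l) (subdiv K n (boundary K E (word K l))) := by
  cases l with
  | nil => exact absurd rfl hl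
  | cons x l => simp [subdiv]

lemma boundary_word_mem_le {α : Type*} {n : ℕ} {l : List α} (hl : l.length ≤ n + 1) :
    boundary K α (word K l) ∈ Finsupp.supported K K {v : List α | v.length ≤ n} := by
  refine Finsupp.supported_mono ?_ (boundary_word_mem l)
  rintro v ⟨-, hv⟩
  simp only [Set.mem_ofPred_eq]
  omega

lemma subdiv_eq_succ (n : ℕ) (l : List E) (hl : l.length ≤ n) :
    subdiv K n (word K l) = subdiv K (n + 1) (word K l) := by
  induction n generalizing l with
  | zero =>
    obtain rfl : l = [] := by simpa using hl
    rw [subdiv_nil, subdiv_nil]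
  | succ n ih =>
    by_cases h : l = []
    · rw [h, subdiv_nil, subdiv_nil]
    · rw [subdiv_succ n h, subdiv_succ (n + 1) h]
      congr 1
      exact eq_of_supported _ _ _ (fun v hv => ih v hv) (boundary_word_mem_le hl)

lemma boundary_subdiv_word (n : ℕ) (l : List E) (hl : l.length ≤ n) :
    boundary K E (subdiv K n (word K l)) = subdiv K n (boundary K E (word K l)) := by
  induction n generalizing l with
  | zero => rfl
  | succ n ih =>
    by_cases h : l = []
    · subst h
      rw [subdiv_nil, boundary_nil, map_zero]
    · have h1 : boundary K E (subdiv K n (boundary K E (word K l))) = 0 := by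
        refine (eq_of_supported (boundary K E ∘ₗ subdiv K n) (subdiv K n ∘ₗ boundary K E) _
          (fun v hv => ih v hv) (boundary_word_mem_le hl)).trans ?_
        rw [LinearMap.comp_apply, boundary_boundary, map_zero]
      rw [subdiv_succ n h, boundary_consChain, h1, map_zero, sub_zero]
      exact eq_of_supported _ _ _ (fun v hv => subdiv_eq_succ n v hv) (boundary_word_mem_le hl)

lemma bary_map (A : E →ₗ[ℝ] E) (l : List E) : bary (l.map A) = A (bary l) := by
  rw [bary, bary, map_smul, map_list_sum, List.length_map]

lemma subdiv_mapChain (A : E →ₗ[ℝ] E) (n : ℕ) (c : Chain K E) :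
    subdiv K n (mapChain K A c) = mapChain K A (subdiv K n c) := by
  induction n generalizing c with
  | zero => rfl
  | succ n ih =>
    refine eq_of_supported (subdiv K (n + 1) ∘ₗ mapChain K A) (mapChain K A ∘ₗ subdiv K (n + 1))
      Set.univ (fun l _ => ?_) (by simp)
    rw [LinearMap.comp_apply, LinearMap.comp_apply, mapChain_single]
    by_cases h : l = []
    · subst h
      rw [List.map_nil, subdiv_nil, mapChain_single, List.map_nil]
    · have h' : l.map A ≠ [] := by simpa using h
      rw [subdiv_succ n h, subdiv_succ n h', mapChain_consChain, bary_map, ← ih, mapChain_boundary,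
        mapChain_single]

omit [NormedSpace ℝ E] in
lemma norm_sum_sub_le {l : List E} {D : ℝ} (hD : ∀ x ∈ l, ∀ y ∈ l, ‖x - y‖ ≤ D) {v : E}
    (hv : v ∈ l) : ‖(l.map fun x => x - v).sum‖ ≤ (l.length - 1 : ℝ) * D := by
  have key : ∀ s : List E, (∀ x ∈ s, ‖x - v‖ ≤ D) →
      ‖(s.map fun x => x - v).sum‖ ≤ (s.length : ℝ) * D := by
    intro s hs
    induction s with
    | nil => simp
    | cons x s ih =>
      simp only [List.map_cons, List.sum_cons, List.length_cons]
      refine (norm_add_le _ _).trans ?_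
      have h1 := hs x (by simp)
      have h2 := ih fun y hy => hs y (by simp [hy])
      push_cast
      linarith
  obtain ⟨s, t, rfl⟩ := List.append_of_mem hv
  have h1 := key (s ++ t) fun x hx => hD x (by simp at hx ⊢; tauto) v hv
  have h2 : ((s ++ v :: t).map fun x => x - v).sum = ((s ++ t).map fun x => x - v).sum := by simp
  rw [h2]
  convert h1 using 2
  simp
  ring

lemma norm_sub_bary_le {l : List E} {n : ℕ} (hl : l.length ≤ n) {D : ℝ}
    (hD : ∀ x ∈ l, ∀ y ∈ l, ‖x - y‖ ≤ D) {x : E} (hx : x ∈ convexHull ℝ {x | x ∈ l}) :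
    ‖x - bary l‖ ≤ (1 - (n : ℝ)⁻¹) * D := by
  have hsub : {x | x ∈ l} ⊆ Metric.closedBall (bary l) ((1 - (n : ℝ)⁻¹) * D) := by
    intro v hv
    have hv : v ∈ l := hv
    have hpos : 0 < l.length := List.length_pos_of_mem hv
    have hpos' : (0 : ℝ) < l.length := by exact_mod_cast hpos
    have hD0 : 0 ≤ D := (norm_nonneg _).trans (hD v hv v hv)
    rw [mem_closedBall_iff_norm']
    have e : bary l - v = (l.length : ℝ)⁻¹ • (l.map fun x => x - v).sum := by
      have : ∀ s : List E, (s.map fun x => x - v).sum = s.sum - (s.length : ℝ) • v := by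
        intro s
        induction s with
        | nil => simp
        | cons x s ih =>
          simp only [List.map_cons, List.sum_cons, List.length_cons, ih]
          push_cast
          module
      rw [this, smul_sub, smul_smul, inv_mul_cancel₀ hpos'.ne', one_smul, bary]
    rw [e, norm_smul, norm_inv, Real.norm_natCast]
    calc (l.length : ℝ)⁻¹ * ‖(l.map fun x => x - v).sum‖
        ≤ (l.length : ℝ)⁻¹ * ((l.length - 1 : ℝ) * D) := by
          gcongr
          exact norm_sum_sub_le hD hv
      _ = (1 - (l.length : ℝ)⁻¹) * D := by field_simp
      _ ≤ (1 - (n : ℝ)⁻¹) * D := by gcongr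
  have := convexHull_min hsub (convex_closedBall _ _) hx
  rwa [mem_closedBall_iff_norm] at this

/-- Words of `m` points of a convex set at mutual distance at most `D`. -/
def smallWords (C : Set E) (m : ℕ) (D : ℝ) : Set (List E) :=
  {l | l.length = m ∧ (∀ x ∈ l, x ∈ C) ∧ ∀ x ∈ l, ∀ y ∈ l, ‖x - y‖ ≤ D}

lemma subdiv_word_mem {n : ℕ} (hn : 0 < n) (k : ℕ) (hk : k ≤ n) {C : Set E} (hC : Convex ℝ C)
    {D : ℝ} (hD0 : 0 ≤ D) {l : List E} (hlk : l.length ≤ k) (hlC : ∀ x ∈ l, x ∈ C)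
    (hD : ∀ x ∈ l, ∀ y ∈ l, ‖x - y‖ ≤ D) :
    subdiv K k (word K l) ∈
      Finsupp.supported K K (smallWords C l.length ((1 - (n : ℝ)⁻¹) * D)) := by
  induction k generalizing l C with
  | zero =>
    obtain rfl : l = [] := by simpa using hlk
    rw [subdiv_nil]
    exact word_mem_supported ⟨rfl, by simp, by simp⟩
  | succ k ih =>
    by_cases h : l = []
    · subst h
      rw [subdiv_nil]
      exact word_mem_supported ⟨rfl, by simp, by simp⟩
    have hlpos : 0 < l.length := List.length_pos_iff.2 h
    have hθ : 0 ≤ (1 - (n : ℝ)⁻¹) * D := by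
      have : (n : ℝ)⁻¹ ≤ 1 := inv_le_one_of_one_le₀ (by exact_mod_cast hn)
      exact mul_nonneg (by linarith) hD0
    have hconv : convexHull ℝ {x | x ∈ l} ⊆ C := convexHull_min (fun x hx => hlC x hx) hC
    have hbary : bary l ∈ convexHull ℝ {x | x ∈ l} := by
      have hs : l.sum = ∑ i : Fin l.length, l[i] := by
        rw [← List.sum_ofFn]; simp
      rw [bary, hs, Finset.smul_sum]
      refine (convex_convexHull ℝ _).sum_mem (fun _ _ => by positivity) ?_
        fun i _ => subset_convexHull _ _ (List.getElem_mem _)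
      simp [hlpos.ne']
    rw [subdiv_succ k h]
    have h1 : subdiv K k (boundary K E (word K l)) ∈ Finsupp.supported K K
        (smallWords (convexHull ℝ {x | x ∈ l}) (l.length - 1) ((1 - (n : ℝ)⁻¹) * D)) := by
      refine map_mem_of_supported _ _ _ (fun v hv => ?_) (boundary_word_mem l)
      have hvl := hv.2
      have := ih (by omega) (convex_convexHull ℝ {x | x ∈ l}) (l := v) (by omega)
        (fun x hx => subset_convexHull _ _ (hv.1.subset hx))
        (fun x hx y hy => hD x (hv.1.subset hx) y (hv.1.subset hy))
      rwa [show v.length = l.length - 1 by omega] at this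
    refine map_mem_of_supported _ _ _ (fun v hv => ?_) h1
    rw [consChain_word]
    refine word_mem_supported ⟨by have := hv.1; simp only [List.length_cons]; omega, ?_, ?_⟩
    · intro x hx
      rcases List.mem_cons.1 hx with rfl | hx
      · exact hconv hbary
      · exact hconv (hv.2.1 x hx)
    · intro x hx y hy
      have hb : ∀ z ∈ v, ‖z - bary l‖ ≤ (1 - (n : ℝ)⁻¹) * D := fun z hz =>
        norm_sub_bary_le (by omega) hD (hv.2.1 z hz)
      rcases List.mem_cons.1 hx with rfl | hx <;> rcases List.mem_cons.1 hy with rfl | hy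
      · simpa using hθ
      · rw [norm_sub_rev]; exact hb y hy
      · exact hb x hx
      · exact hv.2.2 x hx y hy

lemma subdiv_pow_mem {n : ℕ} (hn : 0 < n) {C : Set E} (hC : Convex ℝ C) {D : ℝ} (hD0 : 0 ≤ D)
    {m : ℕ} (hm : m ≤ n) (N : ℕ) {c : Chain K E}
    (hc : c ∈ Finsupp.supported K K (smallWords C m D)) :
    (subdiv K n ^ N) c ∈
      Finsupp.supported K K (smallWords C m ((1 - (n : ℝ)⁻¹) ^ N * D)) := by
  have hθ : 0 ≤ 1 - (n : ℝ)⁻¹ := by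
    have : (n : ℝ)⁻¹ ≤ 1 := inv_le_one_of_one_le₀ (by exact_mod_cast hn)
    linarith
  induction N with
  | zero => simpa using hc
  | succ N ih =>
    rw [pow_succ' (subdiv K n), Module.End.mul_apply]
    refine map_mem_of_supported _ _ _ (fun l hl => ?_) ih
    have := subdiv_word_mem (K := K) hn n le_rfl hC (mul_nonneg (pow_nonneg hθ N) hD0)
      (hl.1.le.trans hm) hl.2.1 hl.2.2
    rwa [hl.1, ← mul_assoc, ← pow_succ'] at this

lemma boundary_subdiv_pow {n : ℕ} (hn : 0 < n) {C : Set E} (hC : Convex ℝ C) {D : ℝ}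
    (hD0 : 0 ≤ D) {m : ℕ} (hm : m ≤ n) (N : ℕ) {c : Chain K E}
    (hc : c ∈ Finsupp.supported K K (smallWords C m D)) :
    boundary K E ((subdiv K n ^ N) c) = (subdiv K n ^ N) (boundary K E c) := by
  induction N with
  | zero => rfl
  | succ N ih =>
    rw [pow_succ' (subdiv K n), Module.End.mul_apply, Module.End.mul_apply, ← ih]
    exact eq_of_supported (boundary K E ∘ₗ subdiv K n) (subdiv K n ∘ₗ boundary K E) _
      (fun l hl => boundary_subdiv_word n l (hl.1.le.trans hm)) (subdiv_pow_mem hn hC hD0 hm N hc)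

lemma subdiv_pow_mapChain (A : E →ₗ[ℝ] E) (n N : ℕ) (c : Chain K E) :
    (subdiv K n ^ N) (mapChain K A c) = mapChain K A ((subdiv K n ^ N) c) := by
  induction N with
  | zero => rfl
  | succ N ih =>
    rw [pow_succ' (subdiv K n), Module.End.mul_apply, Module.End.mul_apply, ih, subdiv_mapChain]

end Subdivision

section Labelling

variable {F : Type*} [Fintype F]

/-- Faces of the standard simplex. -/
def face {F : Type*} [Fintype F] (w : List F) : Set (F → ℝ) :=
  {y | y ∈ stdSimplex ℝ F ∧ ∀ z, z ∉ w → y z = 0}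

lemma convex_face (w : List F) : Convex ℝ (face w) := by
  refine (convex_stdSimplex ℝ F).inter ?_
  intro x hx y hy a b _ _ _ z hz
  simp [hx z hz, hy z hz]

/-- Translation of coordinates. -/
def shift {F : Type*} [AddCommGroup F] (a : F) : (F → ℝ) →ₗ[ℝ] (F → ℝ) :=
  LinearMap.funLeft ℝ ℝ fun z => z - a

lemma shift_apply {F : Type*} [AddCommGroup F] (a : F) (y : F → ℝ) (z : F) :
    shift a y z = y (z - a) := rfl

lemma shift_single {F : Type*} [AddCommGroup F] [DecidableEq F] (a z : F) :
    shift a (Pi.single z 1) = Pi.single (a + z) 1 := by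
  ext x
  simp only [shift_apply, Pi.single_apply, sub_eq_iff_eq_add, add_comm a z]

/-- A labelling of the faces of a simplex, by elements of a finite field which also indexes the
vertices, that is natural for inclusions of faces and equivariant under translations has
arbitrarily small fully labelled simplices. -/
theorem exists_fully_labelled (p : ℕ) [Fact p.Prime] [Field F] [Algebra (ZMod p) F]
    (Λ : List F → (F → ℝ) → F)
    (hface : ∀ v w : List F, v.Sublist w → w.Nodup → ∀ y ∈ face v, Λ w y = Λ v y)
    (hshift : ∀ (a : F) (w : List F) (y : F → ℝ), w ≠ [] →
      Λ (w.map fun x => a + x) (shift a y) = a + Λ w y) {δ : ℝ} (hδ : 0 < δ) :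
    ∃ w : List F, w.Nodup ∧ (∀ z, z ∈ w) ∧ ∃ P : F → F → ℝ, (∀ z, P z ∈ stdSimplex ℝ F) ∧
      (∀ z z', ‖P z - P z'‖ ≤ δ) ∧ ∀ z, Λ w (P z) = z := by
  classical
  have : CharP F p := charP_of_injective_algebraMap (algebraMap (ZMod p) F).injective p
  set n := Fintype.card F with hn
  have hn0 : 0 < n := Fintype.card_pos
  obtain ⟨N, hN⟩ : ∃ N : ℕ, (1 - (n : ℝ)⁻¹) ^ N < δ := by
    refine exists_pow_lt_of_lt_one hδ ?_
    have : (0 : ℝ) < (n : ℝ)⁻¹ := by positivity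
    linarith
  set e : F → (F → ℝ) := fun z => Pi.single z 1 with he
  have hsmall : ∀ w : List F, word F (w.map e) ∈
      Finsupp.supported F F (smallWords (face w) w.length 1) := by
    intro w
    refine word_mem_supported ⟨by simp, ?_, ?_⟩
    · intro x hx
      obtain ⟨z, hz, rfl⟩ := List.mem_map.1 hx
      refine ⟨single_mem_stdSimplex ℝ z, fun z' hz' => ?_⟩
      have : z' ≠ z := by rintro rfl; exact hz' hz
      simp [he, this]
    · intro x hx y hy
      obtain ⟨z, hz, rfl⟩ := List.mem_map.1 hx
      obtain ⟨z', hz', rfl⟩ := List.mem_map.1 hy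
      rw [pi_norm_le_iff_of_nonneg zero_le_one]
      intro i
      simp only [he, Pi.sub_apply, Pi.single_apply]
      split_ifs <;> simp
  have hsd : ∀ w : List F, w.length ≤ n → (subdiv F n ^ N) (word F (w.map e)) ∈
      Finsupp.supported F F (smallWords (face w) w.length ((1 - (n : ℝ)⁻¹) ^ N * 1)) :=
    fun w hw => subdiv_pow_mem hn0 (convex_face w) zero_le_one hw N (hsmall w)
  set Φ : Chain F F →ₗ[F] AltChain F F := Finsupp.linearCombination F fun w =>
    (altRel F F).mkQ (mapChain F (Λ w) ((subdiv F n ^ N) (word F (w.map e)))) with hΦ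
  have hΦw : ∀ w, Φ (word F w) =
      (altRel F F).mkQ (mapChain F (Λ w) ((subdiv F n ^ N) (word F (w.map e)))) := by
    intro w; simp [hΦ]
  have hnil : ∀ N : ℕ, (subdiv F n ^ N) (word F ([] : List (F → ℝ))) = word F [] := by
    intro N
    induction N with
    | zero => rfl
    | succ N ih => rw [pow_succ' (subdiv F n), Module.End.mul_apply, ih, subdiv_nil]
  set b := Module.finBasis (ZMod p) F
  suffices hw : ∃ w : List F, w.Nodup ∧ w.length = Fintype.card F ∧ Φ (word F w) ≠ 0 by
    obtain ⟨w, hw, hlen, hne⟩ := hw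
    have hall : ∀ z, z ∈ w := by
      have h1 : w.toFinset = Finset.univ := by
        rw [← Finset.card_eq_iff_eq_univ, List.toFinset_card_of_nodup hw, hlen]
      intro z
      rw [← List.mem_toFinset, h1]
      exact Finset.mem_univ z
    obtain ⟨l, hl, hln⟩ : ∃ l ∈ smallWords (face w) w.length ((1 - (n : ℝ)⁻¹) ^ N * 1),
        (l.map (Λ w)).Nodup := by
      by_contra! hcon
      refine hne ?_
      have : Φ (word F w) ∈ (⊥ : Submodule F (AltChain F F)) := by
        rw [hΦw]
        refine map_mem_of_supported ((altRel F F).mkQ ∘ₗ mapChain F (Λ w)) _ _ (fun l hl => ?_)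
          (hsd w hlen.le)
        rw [LinearMap.comp_apply, mapChain_single]
        exact altWord_eq_zero (hcon l hl)
      exact (Submodule.mem_bot F).1 this
    have hcov : ∀ z, z ∈ l.map (Λ w) := by
      have h1 : (l.map (Λ w)).toFinset = Finset.univ := by
        rw [← Finset.card_eq_iff_eq_univ, List.toFinset_card_of_nodup hln, List.length_map, hl.1,
          hlen]
      intro z
      rw [← List.mem_toFinset, h1]
      exact Finset.mem_univ z
    have hP : ∀ z, ∃ x ∈ l, Λ w x = z := fun z => by simpa using hcov z
    choose P hPl hPz using hP
    refine ⟨w, hw, hall, P, fun z => (hl.2.1 _ (hPl z)).1, fun z z' => ?_, hPz⟩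
    have := hl.2.2 _ (hPl z) _ (hPl z')
    linarith
  refine exists_top_ne_zero (p := p) b b (fun χ hχ h0 => hχ ?_) Φ ?_ ?_ ?_
  · refine b.ext fun i => ?_
    have h1 : ∑ i, χ (b i) • b i = 0 := by
      rw [← h0]
      refine Finset.sum_congr rfl fun i _ => ?_
      rw [Algebra.smul_def, mul_comm]
    exact Fintype.linearIndependent_iff.1 b.linearIndependent _ h1 i
  · rw [hΦw, List.map_nil, hnil, mapChain_single, List.map_nil]
    rfl
  · intro a
    refine chain_hom_ext fun w => ?_
    rcases eq_or_ne w [] with rfl | hw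
    · simp only [LinearMap.comp_apply, mapChain_single, hΦw, List.map_nil, hnil]
      rw [← act_altRel_mkQ, act_single, one_smul, mapChain_single, List.map_nil]
    rw [LinearMap.comp_apply, LinearMap.comp_apply, mapChain_single, hΦw, hΦw,
      ← act_altRel_mkQ, act_single, one_smul, mapChain_comp]
    have h1 : word F ((w.map fun x => a + x).map e) = mapChain F (shift a) (word F (w.map e)) := by
      rw [mapChain_single, List.map_map, List.map_map]
      congr 2
      funext z
      exact (shift_single a z).symm
    rw [h1, subdiv_pow_mapChain, mapChain_comp]
    congr 3
    funext y
    exact hshift a w y hw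
  · intro w hw
    have hl : w.length ≤ n := hw.length_le_card
    rw [hΦw, altBoundary_mkQ, ← mapChain_boundary,
      boundary_subdiv_pow hn0 (convex_face w) zero_le_one hl N (hsmall w)]
    have h1 : boundary F (F → ℝ) (word F (w.map e)) = mapChain F e (boundary F F (word F w)) := by
      rw [mapChain_boundary, mapChain_single]
    rw [h1]
    refine eq_of_supported (((altRel F F).mkQ ∘ₗ mapChain F (Λ w)) ∘ₗ
      (subdiv F n ^ N : Module.End F (Chain F (F → ℝ))) ∘ₗ mapChain F e) Φ _
      (fun v hv => ?_) (boundary_word_mem w)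
    rw [hΦw, LinearMap.comp_apply, LinearMap.comp_apply, LinearMap.comp_apply, mapChain_single]
    congr 1
    refine eq_of_supported _ _ _ (fun l hl => ?_) (hsd v (by have := hv.2; omega))
    rw [mapChain_single, mapChain_single]
    congr 1
    refine List.map_congr_left fun y hy => ?_
    exact hface v w hv.1 hw y (hl.2.1 y hy)

end Labelling

section Geometry

variable {F : Type*}

/-- The total weight of the letters strictly before `z` in a word. -/
noncomputable def weightBefore (y : F → ℝ) : List F → F → ℝ
  | [], _ => 0
  | a :: w, z => open Classical in if z = a then 0 else y a + weightBefore y w z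

lemma weightBefore_nonneg {y : F → ℝ} (hy : ∀ z, 0 ≤ y z) (w : List F) (z : F) :
    0 ≤ weightBefore y w z := by
  induction w with
  | nil => exact le_rfl
  | cons a w ih =>
    rw [weightBefore]
    split_ifs
    · exact le_rfl
    · exact add_nonneg (hy a) ih

lemma weightBefore_add_le {y : F → ℝ} (hy : ∀ z, 0 ≤ y z) {w : List F} {z : F}
    (hz : z ∉ w → y z = 0) : weightBefore y w z + y z ≤ (w.map y).sum := by
  induction w with
  | nil => simp [weightBefore, hz]
  | cons a w ih =>
    rw [weightBefore, List.map_cons, List.sum_cons]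
    split_ifs with h
    · subst h
      have : 0 ≤ (w.map y).sum := List.sum_nonneg (by simpa using fun a _ => hy a)
      linarith
    · have := ih fun hw => hz (by simp [h, hw])
      linarith

lemma weightBefore_separated {y : F → ℝ} (hy : ∀ z, 0 ≤ y z) {w : List F} {x z : F} (hxz : x ≠ z)
    (hx : x ∉ w → y x = 0) (hz : z ∉ w → y z = 0) :
    weightBefore y w x + y x ≤ weightBefore y w z ∨
      weightBefore y w z + y z ≤ weightBefore y w x := by
  induction w with
  | nil => simp [weightBefore, hx]
  | cons a w ih =>
    simp only [weightBefore]
    by_cases hxa : x = a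
    · subst hxa
      rw [if_pos rfl, if_neg hxz.symm]
      have := weightBefore_nonneg hy w z
      left; linarith
    by_cases hza : z = a
    · subst hza
      rw [if_pos rfl, if_neg hxz]
      have := weightBefore_nonneg hy w x
      right; linarith
    rw [if_neg hxa, if_neg hza]
    rcases ih (fun h => hx (by simp [hxa, h])) (fun h => hz (by simp [hza, h])) with h | h
    · left; linarith
    · right; linarith

lemma exists_weightBefore_le {y : F → ℝ} {w : List F} (hw : w.Nodup)
    (hne : w ≠ []) {t : ℝ} (h0 : 0 ≤ t) (ht : t ≤ (w.map y).sum) :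
    ∃ z, weightBefore y w z ≤ t ∧ t ≤ weightBefore y w z + y z := by
  suffices ∃ z ∈ w, weightBefore y w z ≤ t ∧ t ≤ weightBefore y w z + y z by
    obtain ⟨z, -, h⟩ := this
    exact ⟨z, h⟩
  induction w generalizing t with
  | nil => exact absurd rfl hne
  | cons a w ih =>
    rw [List.map_cons, List.sum_cons] at ht
    rcases le_total t (y a) with h | h
    · exact ⟨a, by simp, by simpa [weightBefore] using h0, by simpa [weightBefore] using h⟩
    rcases eq_or_ne w [] with rfl | hw'
    · refine ⟨a, by simp, by simpa [weightBefore] using h0, ?_⟩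
      simpa [weightBefore] using ht
    obtain ⟨z, hz, h1, h2⟩ := ih hw.of_cons hw' (t := t - y a) (by linarith) (by linarith)
    have hza : z ≠ a := by
      rintro rfl
      exact (List.nodup_cons.1 hw).1 hz
    refine ⟨z, by simp [hz], ?_, ?_⟩ <;> rw [weightBefore, if_neg hza] <;> linarith

lemma weightBefore_sublist {y : F → ℝ} {v w : List F} (hvw : v.Sublist w) (hw : w.Nodup)
    (hy : ∀ x ∈ w, x ∉ v → y x = 0) {z : F} (hz : z ∈ v) :
    weightBefore y w z = weightBefore y v z := by
  induction hvw with
  | slnil => rfl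
  | @cons v w a hvw ih =>
    have ha : a ∉ v := fun h => (List.nodup_cons.1 hw).1 (hvw.subset h)
    have hza : z ≠ a := by rintro rfl; exact ha hz
    rw [weightBefore, if_neg hza, hy a (by simp) ha, zero_add]
    exact ih hw.of_cons (fun x hx => hy x (by simp [hx])) hz
  | @cons_cons v w a hvw ih =>
    rw [weightBefore, weightBefore]
    split_ifs with h
    · rfl
    · congr 1
      refine ih hw.of_cons (fun x hx hxv => hy x (by simp [hx]) ?_)
        (by simpa [h] using hz)
      have : x ≠ a := by rintro rfl; exact (List.nodup_cons.1 hw).1 hx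
      simp [this, hxv]

lemma continuous_weightBefore (w : List F) (z : F) :
    Continuous fun y : F → ℝ => weightBefore y w z := by
  induction w with
  | nil => exact continuous_const
  | cons a w ih =>
    simp only [weightBefore]
    split_ifs
    · exact continuous_const
    · fun_prop

lemma sum_map_eq_one [Fintype F] {w : List F} (hw : w.Nodup) {y : F → ℝ} (hy : y ∈ face w) :
    (w.map y).sum = 1 := by
  classical
  rw [← List.sum_toFinset _ hw, ← hy.1.2]
  exact Finset.sum_subset (Finset.subset_univ _) fun z _ hz => hy.2 z (by simpa using hz)

lemma weightBefore_shift [AddCommGroup F] (a : F) (w : List F) (y : F → ℝ) (z : F) :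
    weightBefore (shift a y) (w.map fun x => a + x) (a + z) = weightBefore y w z := by
  induction w with
  | nil => rfl
  | cons b w ih =>
    simp only [weightBefore, List.map_cons, ih, shift_apply, add_sub_cancel_left]
    by_cases h : z = b <;> simp [h]

/-- A family of subsets of the line, with the symmetric difference distance. -/
abbrev Cake (F : Type*) := F → Set ℝ

noncomputable instance [Fintype F] : PseudoEMetricSpace (Cake F) where
  edist A B := ∑ z, volume (symmDiff (A z) (B z))
  edist_self A := by simp
  edist_comm A B := by simp only [symmDiff_comm]
  edist_triangle A B C := by
    rw [← Finset.sum_add_distrib]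
    exact Finset.sum_le_sum fun z _ => measure_symmDiff_le _ _ _

lemma Cake.edist_def [Fintype F] (A B : Cake F) :
    edist A B = ∑ z, volume (symmDiff (A z) (B z)) := rfl

lemma volume_symmDiff_Icc_le (a b a' b' : ℝ) :
    volume (symmDiff (Set.Icc a b) (Set.Icc a' b')) ≤
      ENNReal.ofReal |a' - a| + ENNReal.ofReal |b' - b| := by
  have h : symmDiff (Set.Icc a b) (Set.Icc a' b') ⊆ Set.uIcc a a' ∪ Set.uIcc b b' := by
    intro x hx
    simp only [Set.mem_union, Set.mem_uIcc]
    simp only [Set.mem_symmDiff, Set.mem_Icc, not_and_or, not_le] at hx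
    rcases hx with ⟨⟨h1, h2⟩, h | h⟩ | ⟨⟨h1, h2⟩, h | h⟩
    · exact Or.inl (Or.inl ⟨h1, h.le⟩)
    · exact Or.inr (Or.inr ⟨h.le, h2⟩)
    · exact Or.inl (Or.inr ⟨h1, h.le⟩)
    · exact Or.inr (Or.inl ⟨h.le, h2⟩)
  refine (measure_mono h).trans ((measure_union_le _ _).trans ?_)
  rw [Real.volume_interval, Real.volume_interval]

variable [AddCommGroup F] {q : ℕ} (e : Fin q ≃ F)

/-- The left end, in the block `ℓ`, of the piece with index `z`. -/
noncomputable def leftEnd (w : List F) (y : F → ℝ) (z : F) (ℓ : Fin q) : ℝ :=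
  (ℓ + weightBefore y w (z - e ℓ)) / q

/-- The right end, in the block `ℓ`, of the piece with index `z`. -/
noncomputable def rightEnd (w : List F) (y : F → ℝ) (z : F) (ℓ : Fin q) : ℝ :=
  (ℓ + (weightBefore y w (z - e ℓ) + y (z - e ℓ))) / q

/-- The piece with index `z`. -/
def cyclicPiece (w : List F) (y : F → ℝ) (z : F) : Set ℝ :=
  ⋃ ℓ : Fin q, Set.Icc (leftEnd e w y z ℓ) (rightEnd e w y z ℓ)

lemma cyclicPiece_shift (a : F) (w : List F) (y : F → ℝ) (z : F) :
    cyclicPiece e (w.map fun x => a + x) (shift a y) (a + z) = cyclicPiece e w y z := by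
  have h : ∀ ℓ, a + z - e ℓ = a + (z - e ℓ) := fun ℓ => by abel
  simp only [cyclicPiece, leftEnd, rightEnd, h, weightBefore_shift, shift_apply,
    add_sub_cancel_left]

lemma ends_mem_block [Fintype F] {w : List F} (hw : w.Nodup) {y : F → ℝ} (hy : y ∈ face w) (z : F)
    (ℓ : Fin q) : (ℓ : ℝ) / q ≤ leftEnd e w y z ℓ ∧ leftEnd e w y z ℓ ≤ rightEnd e w y z ℓ ∧
      rightEnd e w y z ℓ ≤ ((ℓ : ℝ) + 1) / q := by
  have h1 := weightBefore_nonneg hy.1.1 w (z - e ℓ)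
  have h2 := hy.1.1 (z - e ℓ)
  have h3 := weightBefore_add_le hy.1.1 (hy.2 (z - e ℓ))
  rw [sum_map_eq_one hw hy] at h3
  refine ⟨?_, ?_, ?_⟩ <;> refine div_le_div_of_nonneg_right ?_ (Nat.cast_nonneg q) <;> linarith

lemma map_length_eq [Fintype F] (w : List F) (y : F → ℝ) (z : F) :
    Multiset.map (fun ℓ => rightEnd e w y z ℓ - leftEnd e w y z ℓ) Finset.univ.val =
      Multiset.map (fun x => y x / q) Finset.univ.val := by
  have h : (fun ℓ => rightEnd e w y z ℓ - leftEnd e w y z ℓ) =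
      (fun x => y x / q) ∘ (e.trans (Equiv.subLeft z)) := by
    funext ℓ
    simp only [rightEnd, leftEnd, Function.comp_apply, Equiv.trans_apply, Equiv.subLeft_apply]
    ring
  rw [h, ← Multiset.map_map]
  congr 1
  exact Multiset.map_univ_val_equiv _

lemma isDivision1_perm {A : Fin q → Set ℝ} (hA : IsDivision1 A) (ρ : Equiv.Perm (Fin q)) :
    IsDivision1 fun j => A (ρ j) := by
  refine ⟨fun j => hA.1 _, ?_, fun j j' h => hA.2.2 _ _ (ρ.injective.ne h)⟩
  rw [← hA.2.1]
  exact ρ.surjective.iUnion_comp A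

lemma isDivision1_cyclicPiece [Fintype F] {w : List F} (hw : w.Nodup) {y : F → ℝ}
    (hy : y ∈ face w) : IsDivision1 fun j => cyclicPiece e w y (e j) := by
  classical
  have hq : (0 : ℝ) < q := by
    have : 0 < q := Fin.pos (e.symm 0)
    exact_mod_cast this
  have hsum := sum_map_eq_one hw hy
  have hblock := fun z ℓ => ends_mem_block e hw hy z ℓ
  have hunit : ∀ z ℓ, 0 ≤ leftEnd e w y z ℓ ∧ rightEnd e w y z ℓ ≤ 1 := by
    intro z ℓ
    have hℓ : ((ℓ : ℝ) + 1) ≤ q := by exact_mod_cast ℓ.2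
    exact ⟨(by positivity : (0 : ℝ) ≤ ℓ / q).trans (hblock z ℓ).1,
      (hblock z ℓ).2.2.trans ((div_le_one hq).2 hℓ)⟩
  refine ⟨fun j => ?_, ?_, fun j j' hj => ?_⟩
  · refine ⟨Finset.univ.image fun ℓ => (leftEnd e w y (e j) ℓ, rightEnd e w y (e j) ℓ), ?_, ?_⟩
    · simpa using fun ℓ => hunit (e j) ℓ
    · simp [cyclicPiece]
  · refine Set.Subset.antisymm ?_ ?_
    · refine Set.iUnion_subset fun j => Set.iUnion_subset fun ℓ => ?_
      exact Set.Icc_subset_Icc (hunit _ ℓ).1 (hunit _ ℓ).2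
    · rintro x ⟨hx0, hx1⟩
      obtain ⟨ℓ, hℓ, hℓ'⟩ : ∃ ℓ : Fin q, (ℓ : ℝ) ≤ q * x ∧ q * x ≤ ℓ + 1 := by
        rcases hx1.lt_or_eq with h | rfl
        · have h0 : 0 ≤ q * x := by positivity
          refine ⟨⟨⌊q * x⌋₊, (Nat.floor_lt h0).2 (by nlinarith)⟩, Nat.floor_le h0,
            (Nat.lt_floor_add_one _).le⟩
        · have hq' : 0 < q := by exact_mod_cast hq
          have hc : ((q - 1 : ℕ) : ℝ) = q - 1 := by rw [Nat.cast_sub hq']; simp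
          refine ⟨⟨q - 1, by omega⟩, ?_, ?_⟩ <;> simp [hc]
      have hne : w ≠ [] := by rintro rfl; simp at hsum
      obtain ⟨z, h1, h2⟩ := exists_weightBefore_le hw hne (t := q * x - ℓ) (by linarith)
        (by rw [hsum]; linarith)
      refine Set.mem_iUnion.2 ⟨e.symm (z + e ℓ), Set.mem_iUnion.2 ⟨ℓ, ?_, ?_⟩⟩
      · rw [leftEnd, Equiv.apply_symm_apply, add_sub_cancel_right, div_le_iff₀ hq]
        linarith
      · rw [rightEnd, Equiv.apply_symm_apply, add_sub_cancel_right, le_div_iff₀ hq]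
        linarith
  · have hfin : (cyclicPiece e w y (e j) ∩ cyclicPiece e w y (e j')).Finite := by
      rw [cyclicPiece, cyclicPiece, Set.iUnion_inter_iUnion]
      refine Set.finite_iUnion fun ℓ => Set.finite_iUnion fun ℓ' => Set.Subsingleton.finite ?_
      suffices h : rightEnd e w y (e j) ℓ ≤ leftEnd e w y (e j') ℓ' ∨
          rightEnd e w y (e j') ℓ' ≤ leftEnd e w y (e j) ℓ by
        rintro s ⟨⟨hs1, hs2⟩, hs3, hs4⟩ t ⟨⟨ht1, ht2⟩, ht3, ht4⟩
        rcases h with h | h <;> linarith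
      have hlt : ∀ (z z' : F) (ℓ ℓ' : Fin q), ℓ < ℓ' →
          rightEnd e w y z ℓ ≤ leftEnd e w y z' ℓ' := fun z z' ℓ ℓ' h => by
        refine (hblock z ℓ).2.2.trans (le_trans ?_ (hblock z' ℓ').1)
        have : ((ℓ : ℝ) + 1) ≤ ℓ' := by exact_mod_cast h
        gcongr
      rcases lt_trichotomy ℓ ℓ' with h | rfl | h
      · exact Or.inl (hlt _ _ _ _ h)
      · have hne : e j - e ℓ ≠ e j' - e ℓ := by
          simpa [sub_left_inj] using hj
        rcases weightBefore_separated hy.1.1 hne (hy.2 _) (hy.2 _) with h | h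
        · left
          rw [rightEnd, leftEnd]
          gcongr
        · right
          rw [rightEnd, leftEnd]
          gcongr
      · exact Or.inr (hlt _ _ _ _ h)
    rw [← (isOpen_interior.inter isOpen_interior).measure_eq_zero_iff (volume : Measure ℝ)]
    exact (hfin.subset (Set.inter_subset_inter interior_subset interior_subset)).measure_zero _

lemma volume_symmDiff_cyclicPiece_le (w w' : List F) (y y' : F → ℝ) (z : F) :
    volume (symmDiff (cyclicPiece e w y z) (cyclicPiece e w' y' z)) ≤
      ∑ ℓ, volume (symmDiff (Set.Icc (leftEnd e w y z ℓ) (rightEnd e w y z ℓ))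
        (Set.Icc (leftEnd e w' y' z ℓ) (rightEnd e w' y' z ℓ))) := by
  refine (measure_mono ?_).trans (measure_iUnion_fintype_le _ _)
  rintro x (⟨h1, h2⟩ | ⟨h1, h2⟩) <;> obtain ⟨ℓ, hℓ⟩ := Set.mem_iUnion.1 h1 <;>
    have hn := fun h => h2 (Set.mem_iUnion.2 ⟨ℓ, h⟩) <;> refine Set.mem_iUnion.2 ⟨ℓ, ?_⟩
  · exact Or.inl ⟨hℓ, hn⟩
  · exact Or.inr ⟨hℓ, hn⟩

/-- The division attached to a word and a point of the simplex. -/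
def cyclicCake (w : List F) (y : F → ℝ) : Cake F := cyclicPiece e w y

lemma continuous_cyclicCake [Fintype F] (w : List F) : Continuous (cyclicCake e w) := by
  rw [continuous_iff_continuousAt]
  intro y
  rw [ContinuousAt, tendsto_iff_edist_tendsto_0]
  have hl : ∀ z ℓ, Continuous fun y => leftEnd e w y z ℓ := fun z ℓ => by
    have := continuous_weightBefore w (z - e ℓ)
    unfold leftEnd
    fun_prop
  have hr : ∀ z ℓ, Continuous fun y => rightEnd e w y z ℓ := fun z ℓ => by
    have := continuous_weightBefore w (z - e ℓ)
    unfold rightEnd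
    fun_prop
  have hlim : Filter.Tendsto (fun x => ∑ z, ∑ ℓ,
      (ENNReal.ofReal |leftEnd e w y z ℓ - leftEnd e w x z ℓ| +
        ENNReal.ofReal |rightEnd e w y z ℓ - rightEnd e w x z ℓ|)) (nhds y) (nhds 0) := by
    have hc : Continuous fun x => ∑ z, ∑ ℓ,
        (ENNReal.ofReal |leftEnd e w y z ℓ - leftEnd e w x z ℓ| +
          ENNReal.ofReal |rightEnd e w y z ℓ - rightEnd e w x z ℓ|) := by
      refine continuous_finsetSum _ fun z _ => continuous_finsetSum _ fun ℓ _ => ?_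
      exact (ENNReal.continuous_ofReal.comp (continuous_const.sub (hl z ℓ)).abs).add
        (ENNReal.continuous_ofReal.comp (continuous_const.sub (hr z ℓ)).abs)
    simpa using hc.tendsto y
  refine tendsto_of_tendsto_of_tendsto_of_le_of_le tendsto_const_nhds hlim
    (fun _ => zero_le) fun x => ?_
  refine Finset.sum_le_sum fun z _ => (volume_symmDiff_cyclicPiece_le e w w x y z).trans ?_
  exact Finset.sum_le_sum fun ℓ _ => volume_symmDiff_Icc_le _ _ _ _

lemma edist_cyclicCake_eq_zero [Fintype F] {v w : List F} (hvw : v.Sublist w) (hw : w.Nodup)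
    {y : F → ℝ} (hy : y ∈ face v) : edist (cyclicCake e w y) (cyclicCake e v y) = 0 := by
  rw [Cake.edist_def]
  refine Finset.sum_eq_zero fun z _ => le_antisymm ?_ zero_le
  refine (volume_symmDiff_cyclicPiece_le e w v y y z).trans ?_
  refine (Finset.sum_eq_zero fun ℓ _ => ?_).le
  by_cases hz : z - e ℓ ∈ v
  · rw [leftEnd, leftEnd, rightEnd, rightEnd,
      weightBefore_sublist hvw hw (fun x _ hx => hy.2 x hx) hz]
    simp
  · simp only [leftEnd, rightEnd, hy.2 _ hz, add_zero, Set.Icc_self]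
    exact measure_mono_null (symmDiff_le_sup (α := Set ℝ))
      (((Set.finite_singleton _).union (Set.finite_singleton _)).measure_zero _)

end Geometry

section Balanced

lemma exists_subseq_const_tendsto {T E : Type*} [Finite T] [TopologicalSpace E]
    [FirstCountableTopology E] {K : Set E} (hK : IsCompact K) (τ : ℕ → T) {y : ℕ → E}
    (hy : ∀ t, y t ∈ K) : ∃ s, ∃ a ∈ K, ∃ φ : ℕ → ℕ, StrictMono φ ∧ (∀ t, τ (φ t) = s) ∧
      Filter.Tendsto (y ∘ φ) Filter.atTop (nhds a) := by
  obtain ⟨s, hs⟩ := Finite.exists_infinite_fiber τ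
  have hinf : (τ ⁻¹' {s}).Infinite := Set.infinite_coe_iff.1 hs
  set ψ := Nat.nth (· ∈ τ ⁻¹' {s})
  have hψ : StrictMono ψ := Nat.nth_strictMono hinf
  have hψs : ∀ t, τ (ψ t) = s := fun t => Nat.nth_mem_of_infinite hinf t
  obtain ⟨a, ha, φ, hφ, hlim⟩ := hK.tendsto_subseq (x := y ∘ ψ) fun t => hy _
  exact ⟨s, a, ha, ψ ∘ φ, hψ.comp hφ, fun t => hψs _, hlim⟩

variable {F : Type*} [Fintype F] {q : ℕ} (e : Fin q ≃ F)

/-- The divisions in which the piece `z` is preferred. -/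
def preferred (R : (Fin q → Set ℝ) → Set (Fin q)) (z : F) : Set (Cake F) :=
  {A | IsDivision1 (fun j => A (e j)) ∧ e.symm z ∈ R fun j => A (e j)}

/-- A continuous approximation to the choice function `R`. -/
noncomputable def softChoice (R : (Fin q → Set ℝ) → Set (Fin q)) {ε : ℝ} (hε : 0 < ε) (z : F)
    (A : Cake F) : ℝ :=
  thickenedIndicator hε (preferred e R z) A / ∑ x, (thickenedIndicator hε (preferred e R x) A : ℝ)

variable {R : (Fin q → Set ℝ) → Set (Fin q)} {ε : ℝ} (hε : 0 < ε)

lemma softChoice_nonneg (z : F) (A : Cake F) : 0 ≤ softChoice e R hε z A := by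
  unfold softChoice
  positivity

lemma mem_thickening_of_softChoice_ne_zero {z : F} {A : Cake F} (h : softChoice e R hε z A ≠ 0) :
    A ∈ Metric.thickening ε (preferred e R z) := by
  by_contra hA
  exact h (by rw [softChoice, thickenedIndicator_zero hε _ hA]; simp)

section Division

variable (hne : ∀ A, IsDivision1 A → (R A).Nonempty) {A : Cake F}
  (hA : IsDivision1 fun j => A (e j))
include hne hA

lemma sum_thickenedIndicator_pos :
    0 < ∑ x, (thickenedIndicator hε (preferred e R x) A : ℝ) := by
  obtain ⟨j, hj⟩ := hne _ hA
  have hmem : A ∈ preferred e R (e j) := ⟨hA, by simpa using hj⟩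
  refine Finset.sum_pos' (fun _ _ => NNReal.coe_nonneg _) ⟨e j, Finset.mem_univ _, ?_⟩
  rw [thickenedIndicator_one hε _ hmem]
  exact zero_lt_one

lemma sum_softChoice : ∑ z, softChoice e R hε z A = 1 := by
  simp only [softChoice]
  rw [← Finset.sum_div]
  exact div_self (sum_thickenedIndicator_pos e hε hne hA).ne'

lemma continuousAt_softChoice (z : F) : ContinuousAt (softChoice e R hε z) A := by
  have h : ∀ x, Continuous fun A : Cake F => (thickenedIndicator hε (preferred e R x) A : ℝ) :=
    fun x => NNReal.continuous_coe.comp (thickenedIndicator hε _).continuous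
  exact (h z).continuousAt.div (continuous_finsetSum _ fun x _ => h x).continuousAt
    (sum_thickenedIndicator_pos e hε hne hA).ne'

end Division

lemma softChoice_congr (z : F) {A B : Cake F} (h : edist A B = 0) :
    softChoice e R hε z A = softChoice e R hε z B := by
  have h' : ∀ x, thickenedIndicator hε (preferred e R x) A =
      thickenedIndicator hε (preferred e R x) B := fun x =>
    ((EMetric.inseparable_iff.2 h).map (thickenedIndicator hε _).continuous).eq
  simp only [softChoice, h']

section Translate

variable [AddCommGroup F]
  (hperm : ∀ (ρ : Equiv.Perm (Fin q)) (A : Fin q → Set ℝ) (j : Fin q),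
    j ∈ R (fun j' => A (ρ j')) ↔ ρ j ∈ R A)
include hperm

omit [Fintype F] in
lemma preferred_translate (a z : F) : preferred e R (a + z) =
    (fun A : Cake F => (fun x => A (a + x) : Cake F)) ⁻¹' preferred e R z := by
  ext A
  set ρ : Equiv.Perm (Fin q) := (e.trans (Equiv.addLeft a)).trans e.symm with hρ
  have h1 : (fun j => A (a + e j)) = fun j => (fun j' => A (e j')) (ρ j) := by
    funext j; simp [hρ]
  have h2 : ρ (e.symm z) = e.symm (a + z) := by simp [hρ]
  change _ ∧ _ ↔ IsDivision1 (fun j => A (a + e j)) ∧ e.symm z ∈ R fun j => A (a + e j)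
  rw [h1, hperm ρ fun j' => A (e j'), h2]
  refine and_congr_left' ⟨fun h => isDivision1_perm h ρ, fun h => ?_⟩
  simpa using isDivision1_perm h ρ.symm

lemma softChoice_translate (a z : F) (A : Cake F) :
    softChoice e R hε (a + z) A = softChoice e R hε z (fun x => A (a + x) : Cake F) := by
  set σ : Cake F → Cake F := fun A x => A (a + x) with hσ
  have hiso : Isometry σ := fun A B =>
    Equiv.sum_comp (Equiv.addLeft a) fun z => volume (symmDiff (A z) (B z))
  have hsurj : Function.Surjective σ := fun A =>
    ⟨fun x => A (-a + x), funext fun x => congrArg A (neg_add_cancel_left a x)⟩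
  have key : ∀ x, thickenedIndicator hε (preferred e R (a + x)) A =
      thickenedIndicator hε (preferred e R x) (σ A) := by
    intro x
    have h : Metric.infEDist A (preferred e R (a + x)) =
        Metric.infEDist (σ A) (preferred e R x) := by
      rw [← hsurj.image_preimage (preferred e R x), Metric.infEDist_image hiso,
        preferred_translate e hperm]
    simp only [thickenedIndicator_apply, thickenedIndicatorAux, h]
  unfold softChoice
  rw [key]
  congr 1
  rw [← Equiv.sum_comp (Equiv.addLeft a)]
  simp only [Equiv.coe_addLeft, key]
  rfl

end Translate

variable {ι : Type*} [Fintype ι] (c : ι → (Fin q → Set ℝ) → Set (Fin q))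

/-- The approximate number of agents choosing the piece `z`. -/
noncomputable def demand {ε : ℝ} (hε : 0 < ε) (z : F) (A : Cake F) : ℝ :=
  ∑ i, softChoice e (c i) hε z A

variable (p : ℕ) [Fact p.Prime] [Field F] [Algebra (ZMod p) F]

include p in
lemma exists_equal_demand (hne : ∀ i A, IsDivision1 A → (c i A).Nonempty)
    (hperm : ∀ i (ρ : Equiv.Perm (Fin q)) (A : Fin q → Set ℝ) (j : Fin q),
      j ∈ c i (fun j' => A (ρ j')) ↔ ρ j ∈ c i A) :
    ∃ w : List F, w.Nodup ∧ ∃ y ∈ face w, ∀ z,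
      q * demand e c hε z (cyclicCake e w y) = Fintype.card ι := by
  classical
  set S : List F → (F → ℝ) → Set F := fun w y =>
    {z | ∀ z', demand e c hε z' (cyclicCake e w y) ≤ demand e c hε z (cyclicCake e w y)} with hS
  have hSne : ∀ w y, (S w y).Nonempty := fun w y =>
    Finite.exists_max fun z => demand e c hε z (cyclicCake e w y)
  have hSface : ∀ v w : List F, v.Sublist w → w.Nodup → ∀ y ∈ face v, S w y = S v y := by
    intro v w hvw hw y hy
    have : ∀ z, demand e c hε z (cyclicCake e w y) = demand e c hε z (cyclicCake e v y) :=
      fun z => Finset.sum_congr rfl fun i _ =>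
        softChoice_congr e hε z (edist_cyclicCake_eq_zero e hvw hw hy)
    simp only [hS, this]
  have hdem : ∀ (a : F) w y z,
      demand e c hε (a + z) (cyclicCake e (w.map fun x => a + x) (shift a y)) =
        demand e c hε z (cyclicCake e w y) := by
    intro a w y z
    refine Finset.sum_congr rfl fun i _ => ?_
    rw [softChoice_translate e hε (hperm i)]
    congr 1
    funext x
    exact cyclicPiece_shift e a w y x
  have hSshift : ∀ (a : F) w y z,
      a + z ∈ S (w.map fun x => a + x) (shift a y) ↔ z ∈ S w y := by
    intro a w y z
    simp only [hS, Set.mem_ofPred_eq]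
    rw [← (Equiv.addLeft a).forall_congr_right]
    simp only [Equiv.coe_addLeft, hdem]
  set base : List F → (F → ℝ) → F := fun w y => (w.filter (fun z => y z ≠ 0) ++ w).headD 0
    with hbase
  have hpick : ∀ w y, ∃ z, base w y + z ∈ S w y := fun w y =>
    ⟨(hSne w y).some - base w y, by simpa using (hSne w y).some_mem⟩
  set pick : Set F → F := fun T => if h : T.Nonempty then h.some else 0 with hpickdef
  set Λ : List F → (F → ℝ) → F := fun w y => base w y + pick {z | base w y + z ∈ S w y} with hΛ
  have hΛS : ∀ w y, Λ w y ∈ S w y := by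
    intro w y
    have h : {z | base w y + z ∈ S w y}.Nonempty := hpick w y
    simp only [hΛ, hpickdef, dif_pos h]
    exact h.some_mem
  have hface : ∀ v w : List F, v.Sublist w → w.Nodup → ∀ y ∈ face v, Λ w y = Λ v y := by
    intro v w hvw hw y hy
    have hfil : w.filter (fun z => y z ≠ 0) = v.filter (fun z => y z ≠ 0) := by
      refine ((hvw.filter _).eq_of_length (List.Perm.length_eq ?_)).symm
      refine (List.perm_ext_iff_of_nodup ((hw.sublist hvw).filter _) (hw.filter _)).2 fun z => ?_
      simp only [List.mem_filter]
      refine ⟨fun h => ⟨hvw.subset h.1, h.2⟩, fun h => ⟨?_, h.2⟩⟩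
      by_contra hz
      simp [hy.2 z hz] at h
    have hnil : v.filter (fun z => y z ≠ 0) ≠ [] := by
      intro h
      rw [List.filter_eq_nil_iff] at h
      have h0 : ∀ z, y z = 0 := fun z => by
        by_cases hz : z ∈ v
        · simpa using h z hz
        · exact hy.2 z hz
      have := hy.1.2
      simp [h0] at this
    have hb : base w y = base v y := by
      simp only [hbase, hfil]
      obtain ⟨a, l, hl⟩ := List.exists_cons_of_ne_nil hnil
      rw [hl]
      rfl
    simp only [hΛ, hb, hSface v w hvw hw y hy]
  have hshift : ∀ (a : F) (w : List F) (y : F → ℝ), w ≠ [] →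
      Λ (w.map fun x => a + x) (shift a y) = a + Λ w y := by
    intro a w y hw
    have hb : base (w.map fun x => a + x) (shift a y) = a + base w y := by
      have h1 : (w.map fun x => a + x).filter (fun z => shift a y z ≠ 0) =
          (w.filter fun z => y z ≠ 0).map fun x => a + x := by
        rw [List.filter_map]
        congr 2
        funext x
        simp [shift_apply]
      simp only [hbase]
      rw [h1, ← List.map_append]
      obtain ⟨b, l, hl⟩ := List.exists_cons_of_ne_nil
        (List.append_ne_nil_of_right_ne_nil (w.filter fun z => y z ≠ 0) hw)
      rw [hl]
      rfl
    simp only [hΛ, hb, add_assoc, hSshift]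
  have hfull := fun t : ℕ => exists_fully_labelled p Λ hface hshift
    (δ := 1 / ((t : ℝ) + 1)) Nat.one_div_pos_of_nat
  choose w hw hall P hP hPd hPΛ using hfull
  obtain ⟨s, y, hy, φ, hφ, hs, hlim⟩ := exists_subseq_const_tendsto (T := {l : List F // l.Nodup})
    (isCompact_stdSimplex ℝ F) (fun t => ⟨w t, hw t⟩) (y := fun t => P t 0) fun t => hP t 0
  have hws : ∀ t, w (φ t) = s.1 := fun t => congrArg Subtype.val (hs t)
  have hsall : ∀ z, z ∈ s.1 := fun z => hws 0 ▸ hall (φ 0) z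
  have hyf : y ∈ face s.1 := ⟨hy, fun z hz => absurd (hsall z) hz⟩
  have hdiv : IsDivision1 fun j => cyclicCake e s.1 y (e j) := isDivision1_cyclicPiece e s.2 hyf
  have hlimz : ∀ z, Filter.Tendsto (fun t => P (φ t) z) Filter.atTop (nhds y) := by
    intro z
    have h0 : Filter.Tendsto (fun t => P (φ t) z - P (φ t) 0) Filter.atTop (nhds 0) := by
      refine squeeze_zero_norm (fun t => hPd (φ t) z 0) ?_
      exact tendsto_one_div_add_atTop_nhds_zero_nat.comp hφ.tendsto_atTop
    simpa using h0.add hlim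
  have hcont : ∀ z, ContinuousAt (fun x => demand e c hε z (cyclicCake e s.1 x)) y := by
    intro z
    refine ContinuousAt.comp (f := cyclicCake e s.1) (g := demand e c hε z) ?_
      (continuous_cyclicCake e s.1).continuousAt
    exact tendsto_finsetSum _ fun i _ => continuousAt_softChoice e hε (hne i) hdiv z
  have hle : ∀ z z',
      demand e c hε z' (cyclicCake e s.1 y) ≤ demand e c hε z (cyclicCake e s.1 y) := by
    intro z z'
    refine le_of_tendsto_of_tendsto' ((hcont z').tendsto.comp (hlimz z))
      ((hcont z).tendsto.comp (hlimz z)) fun t => ?_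
    have := hΛS (w (φ t)) (P (φ t) z)
    rw [hPΛ, hws] at this
    exact this z'
  refine ⟨s.1, s.2, y, hyf, fun z => ?_⟩
  have hq : (Fintype.card F : ℝ) = q := by rw [← Fintype.card_congr e, Fintype.card_fin]
  calc q * demand e c hε z (cyclicCake e s.1 y)
      = ∑ z', demand e c hε z' (cyclicCake e s.1 y) := by
        rw [Finset.sum_congr rfl fun z' _ => le_antisymm (hle z z') (hle z' z)]
        simp [hq]
    _ = Fintype.card ι := by
        simp only [demand]
        rw [Finset.sum_comm]
        simp [sum_softChoice e hε (hne _) hdiv]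

include p in
/-- There is a division made of cyclically arranged intervals in which every set of pieces is
demanded by a proportional number of agents. -/
theorem exists_hall_division (hne : ∀ i A, IsDivision1 A → (c i A).Nonempty)
    (hperm : ∀ i (ρ : Equiv.Perm (Fin q)) (A : Fin q → Set ℝ) (j : Fin q),
      j ∈ c i (fun j' => A (ρ j')) ↔ ρ j ∈ c i A)
    (hclosed : ∀ i (A : ℕ → Fin q → Set ℝ) (B : Fin q → Set ℝ),
      (∀ t, IsDivision1 (A t)) → IsDivision1 B →
      (∀ j, Filter.Tendsto (fun t => pieceDist (A t j) (B j)) Filter.atTop (nhds 0)) →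
      ∀ j, (∀ t, j ∈ c i (A t)) → j ∈ c i B) :
    ∃ w : List F, w.Nodup ∧ ∃ y ∈ face w, ∃ N : ι → Set (Fin q),
      (∀ i, N i ⊆ c i fun j => cyclicPiece e w y (e j)) ∧
      ∀ S : Finset (Fin q), S.card * Fintype.card ι ≤ q * Nat.card {i // ∃ j ∈ S, j ∈ N i} := by
  classical
  have hε : ∀ t : ℕ, (0 : ℝ) < 1 / ((t : ℝ) + 1) := fun t => Nat.one_div_pos_of_nat
  choose w hw y hy hdem using fun t : ℕ => exists_equal_demand e (hε t) c p hne hperm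
  obtain ⟨⟨s, N⟩, x, hx, φ, hφ, hs, hlim⟩ := exists_subseq_const_tendsto
    (T := {l : List F // l.Nodup} × (ι → Set F)) (isCompact_stdSimplex ℝ F)
    (fun t => (⟨w t, hw t⟩, fun i =>
      {z | softChoice e (c i) (hε t) z (cyclicCake e (w t) (y t)) ≠ 0}))
    fun t => (hy t).1
  have hws : ∀ t, w (φ t) = s.1 := fun t => congrArg (fun r => r.1.1) (hs t)
  have hN : ∀ t i z, z ∈ N i ↔
      softChoice e (c i) (hε (φ t)) z (cyclicCake e s.1 (y (φ t))) ≠ 0 := by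
    intro t i z
    rw [← hws t]
    exact (Set.ext_iff.1 (congrFun (congrArg Prod.snd (hs t)) i) z).symm
  have hyf : ∀ t, y (φ t) ∈ face s.1 := fun t => hws t ▸ hy (φ t)
  have hxf : x ∈ face s.1 := by
    refine ⟨hx, fun z hz => ?_⟩
    refine tendsto_nhds_unique ((continuous_apply z).continuousAt.tendsto.comp hlim) ?_
    refine tendsto_const_nhds.congr fun t => ?_
    exact ((hyf t).2 z hz).symm
  have hdiv : ∀ {v}, v ∈ face s.1 → IsDivision1 fun j => cyclicCake e s.1 v (e j) :=
    fun hv => isDivision1_cyclicPiece e s.2 hv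
  refine ⟨s.1, s.2, x, hxf, fun i => {j | e j ∈ N i}, fun i j hj => ?_, fun S => ?_⟩
  · have hB : ∀ t, ∃ B ∈ preferred e (c i) (e j),
        edist (cyclicCake e s.1 (y (φ t))) B < ENNReal.ofReal (1 / ((φ t : ℝ) + 1)) := fun t =>
      (Metric.mem_thickening_iff_exists_edist_lt _ _).1
        (mem_thickening_of_softChoice_ne_zero e (hε (φ t)) ((hN t i (e j)).1 hj))
    choose B hB hBd using hB
    have hlimB : Filter.Tendsto (fun t => edist (B t) (cyclicCake e s.1 x)) Filter.atTop
        (nhds 0) := by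
      have h1 : Filter.Tendsto (fun t => edist (cyclicCake e s.1 (y (φ t))) (cyclicCake e s.1 x))
          Filter.atTop (nhds 0) :=
        tendsto_iff_edist_tendsto_0.1 (((continuous_cyclicCake e s.1).tendsto x).comp hlim)
      have h2 : Filter.Tendsto (fun t => ENNReal.ofReal (1 / ((φ t : ℝ) + 1))) Filter.atTop
          (nhds 0) := by
        rw [← ENNReal.ofReal_zero]
        exact ENNReal.tendsto_ofReal
          (tendsto_one_div_add_atTop_nhds_zero_nat.comp hφ.tendsto_atTop)
      have h3 := h2.add h1
      rw [add_zero] at h3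
      refine tendsto_of_tendsto_of_tendsto_of_le_of_le tendsto_const_nhds h3
        (fun _ => zero_le) fun t => ?_
      refine (edist_triangle _ (cyclicCake e s.1 (y (φ t))) _).trans ?_
      gcongr
      rw [edist_comm]
      exact (hBd t).le
    refine hclosed i (fun t j' => B t (e j')) _ (fun t => (hB t).1) (hdiv hxf) (fun j' => ?_) j
      fun t => by simpa using (hB t).2
    have h4 : Filter.Tendsto
        (fun t => volume (symmDiff (B t (e j')) (cyclicCake e s.1 x (e j')))) Filter.atTop
        (nhds 0) := by
      refine tendsto_of_tendsto_of_tendsto_of_le_of_le tendsto_const_nhds hlimB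
        (fun _ => zero_le) fun t => ?_
      exact Finset.single_le_sum (f := fun z => volume (symmDiff (B t z) (cyclicCake e s.1 x z)))
        (fun _ _ => zero_le) (Finset.mem_univ (e j'))
    exact (ENNReal.tendsto_toReal ENNReal.zero_ne_top).comp h4
  · have hd : ∀ z, q * demand e c (hε (φ 0)) z (cyclicCake e s.1 (y (φ 0))) = Fintype.card ι := by
      intro z
      rw [← hws 0]
      exact hdem (φ 0) z
    have hdiv0 := hdiv (hyf 0)
    set A := cyclicCake e s.1 (y (φ 0))
    have hbound : ∀ i, ∑ j ∈ S, softChoice e (c i) (hε (φ 0)) (e j) A ≤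
        if ∃ j ∈ S, e j ∈ N i then 1 else 0 := by
      intro i
      split_ifs with h
      · refine le_of_le_of_eq ?_
          ((e.sum_comp _).trans (sum_softChoice e (hε (φ 0)) (hne i) hdiv0))
        exact Finset.sum_le_univ_sum_of_nonneg fun j => softChoice_nonneg e _ _ _
      · push Not at h
        refine (Finset.sum_eq_zero fun j hj => ?_).le
        have := h j hj
        rw [hN 0] at this
        exact not_not.1 this
    have hreal : (S.card * Fintype.card ι : ℝ) ≤ q * Nat.card {i // ∃ j ∈ S, e j ∈ N i} := by
      calc (S.card * Fintype.card ι : ℝ)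
          = ∑ j ∈ S, q * demand e c (hε (φ 0)) (e j) A := by
            rw [Finset.sum_congr rfl fun j _ => hd (e j), Finset.sum_const, nsmul_eq_mul]
        _ = q * ∑ i, ∑ j ∈ S, softChoice e (c i) (hε (φ 0)) (e j) A := by
            rw [← Finset.mul_sum, Finset.sum_comm]
            rfl
        _ ≤ q * ∑ i, if ∃ j ∈ S, e j ∈ N i then 1 else 0 := by
            gcongr with i
            exact hbound i
        _ = q * Nat.card {i // ∃ j ∈ S, e j ∈ N i} := by
            rw [Finset.sum_boole, Nat.card_eq_fintype_card, Fintype.card_subtype]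
    exact_mod_cast hreal

end Balanced

section Assignment

/-- Hall's theorem for assigning agents to pieces with prescribed numbers of agents per piece. -/
theorem exists_balanced_assignment {ι : Type*} [Fintype ι] {q m r : ℕ} (hr : 0 < r) (hrq : r ≤ q)
    (hι : Fintype.card ι + 1 = m * q + r) (N : ι → Set (Fin q))
    (hN : ∀ S : Finset (Fin q),
      S.card * Fintype.card ι ≤ q * Nat.card {i // ∃ j ∈ S, j ∈ N i}) (jstar : Fin q) :
    ∃ π : ι → Fin q, (∀ i, π i ∈ N i) ∧ Nat.card {i // π i = jstar} = m ∧
      ∀ j, j ≠ jstar → Nat.card {i // π i = j} = m + 1 ∨ r < q ∧ Nat.card {i // π i = j} = m := by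
  classical
  let proj : (Fin q × Fin m) ⊕ {j // j ≠ jstar} → Fin q := Sum.elim Prod.fst Subtype.val
  let t : (Fin q × Fin m) ⊕ {j // j ≠ jstar} → Finset (ι ⊕ Fin (q - r)) := fun s =>
    (Finset.univ.filter fun i => proj s ∈ N i).disjSum (if s.isRight then Finset.univ else ∅)
  have hall : ∀ X : Finset ((Fin q × Fin m) ⊕ {j // j ≠ jstar}), X.card ≤ (X.biUnion t).card := by
    intro X
    set S := X.image proj with hS
    set R := Finset.univ.filter fun i => ∃ j ∈ S, j ∈ N i with hR
    have hNS := hN S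
    rw [Nat.card_eq_fintype_card, Fintype.card_subtype, ← hR] at hNS
    have hXl : X.toLeft.card ≤ S.card * m := by
      calc X.toLeft.card ≤ (S ×ˢ (Finset.univ : Finset (Fin m))).card := by
            refine Finset.card_le_card fun a ha => ?_
            rw [Finset.mem_toLeft] at ha
            exact Finset.mem_product.2
              ⟨Finset.mem_image.2 ⟨_, ha, rfl⟩, Finset.mem_univ _⟩
        _ = S.card * m := by simp
    have hXr : X.toRight.card ≤ (S.erase jstar).card := by
      rw [← Finset.card_map (Function.Embedding.subtype _)]
      refine Finset.card_le_card fun a ha => ?_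
      obtain ⟨b, hb, rfl⟩ := Finset.mem_map.1 ha
      rw [Finset.mem_toRight] at hb
      exact Finset.mem_erase.2 ⟨b.2, Finset.mem_image.2 ⟨_, hb, rfl⟩⟩
    have hX := X.card_toLeft_add_card_toRight
    have hmem : ∀ i ∈ R, Sum.inl i ∈ X.biUnion t := by
      intro i hi
      obtain ⟨j, hj, hji⟩ := (Finset.mem_filter.1 hi).2
      obtain ⟨s, hs, rfl⟩ := Finset.mem_image.1 hj
      exact Finset.mem_biUnion.2 ⟨s, hs, by simpa [t] using hji⟩
    have hSq : S.card ≤ q := by simpa using Finset.card_le_univ S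
    have hq : 0 < q := by omega
    rcases X.toRight.eq_empty_or_nonempty with h0 | ⟨s, hs⟩
    · have h1 : R.card ≤ (X.biUnion t).card := by
        rw [← Finset.card_map Function.Embedding.inl]
        refine Finset.card_le_card fun a ha => ?_
        obtain ⟨i, hi, rfl⟩ := Finset.mem_map.1 ha
        exact hmem i hi
      have h2 : S.card * m ≤ R.card := by
        refine Nat.le_of_mul_le_mul_left ?_ hq
        refine le_trans ?_ hNS
        rw [mul_left_comm]
        exact Nat.mul_le_mul_left _ (by rw [mul_comm]; omega)
      rw [h0, Finset.card_empty] at hX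
      omega
    · have h1 : R.card + (q - r) ≤ (X.biUnion t).card := by
        rw [show R.card + (q - r) = (R.disjSum (Finset.univ : Finset (Fin (q - r)))).card by simp]
        refine Finset.card_le_card fun a ha => ?_
        rcases Finset.mem_disjSum.1 ha with ⟨i, hi, rfl⟩ | ⟨k, -, rfl⟩
        · exact hmem i hi
        · exact Finset.mem_biUnion.2 ⟨_, Finset.mem_toRight.1 hs, by simp [t]⟩
      obtain ⟨d, hd⟩ : ∃ d, q - r = d := ⟨_, rfl⟩
      have hRd : R.card + d ≤ (X.biUnion t).card := hd ▸ h1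
      have hqd : q = r + d := by omega
      rcases hSq.lt_or_eq with hlt | heq
      · have h2 : S.card * (m + 1) ≤ R.card + d := by
          by_contra! hcon
          zify at hNS hcon hlt hι hqd
          rw [eq_sub_of_add_eq hι] at hNS
          have h3 : (q : ℤ) * (R.card + d + 1) ≤ q * (S.card * (m + 1)) :=
            mul_le_mul_of_nonneg_left hcon (by positivity)
          have h4 : (0 : ℤ) < (q - S.card) * (d + 1) := mul_pos (by linarith) (by positivity)
          have h5 : (r : ℤ) = q - d := by linarith
          rw [h5] at hNS
          linarith
        have h3 := (S.erase jstar).card_le_card (S.erase_subset jstar)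
        rw [mul_add, mul_one] at h2
        omega
      · have hSu : S = Finset.univ := by
          rw [← Finset.card_eq_iff_eq_univ, heq, Fintype.card_fin]
        have h2 : Fintype.card ι ≤ R.card := by
          rw [heq] at hNS
          exact Nat.le_of_mul_le_mul_left hNS hq
        rw [hSu, Finset.card_erase_of_mem (Finset.mem_univ _), Finset.card_univ,
          Fintype.card_fin] at hXr
        rw [heq, mul_comm] at hXl
        omega
  obtain ⟨f, hf, hft⟩ := (Finset.all_card_le_biUnion_card_iff_exists_injective t).1 hall
  have hcard : Fintype.card ((Fin q × Fin m) ⊕ {j // j ≠ jstar}) =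
      Fintype.card (ι ⊕ Fin (q - r)) := by
    simp only [Fintype.card_sum, Fintype.card_prod, Fintype.card_fin, ne_eq,
      Fintype.card_subtype_compl, Fintype.card_unique]
    rw [mul_comm]
    omega
  let E := Equiv.ofBijective f ((Fintype.bijective_iff_injective_and_card f).2 ⟨hf, hcard⟩)
  have hcount : ∀ j, Nat.card {i // proj (E.symm (Sum.inl i)) = j} =
      m + ∑ x : {j // j ≠ jstar}, if x.1 = j ∧ (f (Sum.inr x)).isLeft then 1 else 0 := by
    intro j
    have hl : ∀ a, (f (Sum.inl a)).isLeft := by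
      intro a
      have := hft (Sum.inl a)
      cases hfa : f (Sum.inl a) with
      | inl i => rfl
      | inr k => rw [hfa] at this; simp [t] at this
    calc Nat.card {i // proj (E.symm (Sum.inl i)) = j}
        = ∑ a, if proj (E.symm a) = j ∧ a.isLeft then 1 else 0 := by
          rw [Nat.card_eq_fintype_card, Fintype.card_subtype, Finset.card_filter,
            Fintype.sum_sum_type]
          simp only [Sum.isLeft_inl, Sum.isLeft_inr, and_true, Bool.false_eq_true, and_false,
            if_false, Finset.sum_const_zero, add_zero]
      _ = ∑ s, if proj s = j ∧ (f s).isLeft then 1 else 0 := by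
          rw [← E.sum_comp]
          simp only [Equiv.symm_apply_apply]
          rfl
      _ = _ := by
          rw [Fintype.sum_sum_type, Fintype.sum_prod_type]
          simp only [proj, Sum.elim_inl, Sum.elim_inr, hl, and_true]
          congr 1
          simp
  refine ⟨fun i => proj (E.symm (Sum.inl i)), fun i => ?_, ?_, fun j hj => ?_⟩
  · have h := hft (E.symm (Sum.inl i))
    rw [show f (E.symm (Sum.inl i)) = Sum.inl i from E.apply_symm_apply _] at h
    simpa [t] using h
  · rw [hcount, Finset.sum_eq_zero, add_zero]
    intro x _
    simp [x.2]
  · rw [hcount, Finset.sum_eq_single ⟨j, hj⟩ (fun x _ hx => if_neg fun h => hx (Subtype.ext h.1))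
      (by simp)]
    cases hfj : f (Sum.inr ⟨j, hj⟩) with
    | inl i => simp
    | inr k =>
      right
      have := k.2
      exact ⟨by omega, by simp⟩

end Assignment

lemma card_fiber_lastCases {N : ℕ} {α : Type*} [DecidableEq α] (π : Fin N → α) (x j : α) :
    (Finset.univ.filter fun i => Fin.lastCases (motive := fun _ => α) x π i = j).card =
      Nat.card {i // π i = j} + if x = j then 1 else 0 := by
  rw [Finset.card_filter, Fin.sum_univ_castSucc, Nat.card_eq_fintype_card, Fintype.card_subtype,
    Finset.card_filter]
  simp

end CakeDivision

/-- Proposition: envy-free cake division with pieces of equal size. For `n`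
agents with closed preferences on divisions of `[0,1]` into `q` pieces (agent `n` being the
birthday agent), where `q ≤ n` is a prime power, there is a division `A = (A_1,…,A_q)` such
that each `A_j` is a union of `q` closed subintervals, one contained in each block
`[ℓ/q, (ℓ+1)/q]`, the multiset of lengths of these `q` subintervals is the same for every `j`,
and for every `j*` there is an assignment `π : [n] → [q]` with `π(n) = j*`, each non-birthday
agent assigned a preferred piece, and each piece assigned `⌊n/q⌋` or `⌈n/q⌉` agents. -/
theorem stmt15 (n q p k : ℕ) (hp : p.Prime) (hk : 0 < k) (hq : q = p ^ k) (hqn : q ≤ n)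
    (c : Fin n → (Fin q → Set ℝ) → Set (Fin q))
    (hne : ∀ i A, IsDivision1 A → (c i A).Nonempty)
    (hperm : ∀ i (ρ : Equiv.Perm (Fin q)) (A : Fin q → Set ℝ) (j : Fin q),
      j ∈ c i (fun j' => A (ρ j')) ↔ ρ j ∈ c i A)
    (hclosed : ∀ i (A : ℕ → Fin q → Set ℝ) (B : Fin q → Set ℝ),
      (∀ t, IsDivision1 (A t)) → IsDivision1 B →
      (∀ j, Filter.Tendsto (fun t => pieceDist (A t j) (B j)) Filter.atTop (nhds 0)) →
      ∀ j, (∀ t, j ∈ c i (A t)) → j ∈ c i B) :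
    ∃ u w : Fin q → Fin q → ℝ,
      (∀ j ℓ : Fin q, (ℓ : ℝ) / q ≤ u j ℓ ∧ u j ℓ ≤ w j ℓ ∧ w j ℓ ≤ ((ℓ : ℝ) + 1) / q) ∧
      (∀ j j' : Fin q,
        Multiset.map (fun ℓ => w j ℓ - u j ℓ) Finset.univ.val =
        Multiset.map (fun ℓ => w j' ℓ - u j' ℓ) Finset.univ.val) ∧
      IsDivision1 (fun j => ⋃ ℓ : Fin q, Set.Icc (u j ℓ) (w j ℓ)) ∧
      ∀ jstar : Fin q, ∃ π : Fin n → Fin q,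
        π ⟨n - 1, by
          have h1 : 0 < q := by rw [hq]; exact pow_pos hp.pos k
          omega⟩ = jstar ∧
        (∀ i : Fin n, (i : ℕ) < n - 1 →
          π i ∈ c i (fun j => ⋃ ℓ : Fin q, Set.Icc (u j ℓ) (w j ℓ))) ∧
        (∀ j : Fin q,
          ((Finset.univ.filter fun i => π i = j).card : ℤ) = ⌊(n : ℚ) / (q : ℚ)⌋ ∨
          ((Finset.univ.filter fun i => π i = j).card : ℤ) = ⌈(n : ℚ) / (q : ℚ)⌉) := by
  classical
  have : Fact p.Prime := ⟨hp⟩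
  have hq0 : 0 < q := hq ▸ pow_pos hp.pos k
  have : Fintype (GaloisField p k) := Fintype.ofFinite _
  have hcardF : Fintype.card (GaloisField p k) = q := by
    rw [← Nat.card_eq_fintype_card, GaloisField.card p k hk.ne', hq]
  let e : Fin q ≃ GaloisField p k := (Fintype.equivFinOfCardEq hcardF).symm
  obtain ⟨N, rfl⟩ : ∃ N, n = N + 1 := ⟨n - 1, by omega⟩
  obtain ⟨w, hw, y, hy, T, hTc, hT⟩ := CakeDivision.exists_hall_division e
    (fun i : Fin N => c i.castSucc) p (fun i => hne _) (fun i => hperm _) (fun i => hclosed _)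
  refine ⟨fun j ℓ => CakeDivision.leftEnd e w y (e j) ℓ,
    fun j ℓ => CakeDivision.rightEnd e w y (e j) ℓ,
    fun j ℓ => CakeDivision.ends_mem_block e hw hy _ ℓ, fun j j' => ?_,
    CakeDivision.isDivision1_cyclicPiece e hw hy, fun jstar => ?_⟩
  · exact (CakeDivision.map_length_eq e w y _).trans (CakeDivision.map_length_eq e w y _).symm
  obtain ⟨m, r, hr, hrq, hmr⟩ : ∃ m r, 0 < r ∧ r ≤ q ∧ N + 1 = m * q + r :=
    ⟨N / q, N % q + 1, by omega, Nat.mod_lt _ hq0, by rw [← add_assoc, Nat.div_add_mod']⟩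
  obtain ⟨π, hπ, hπs, hπj⟩ := CakeDivision.exists_balanced_assignment hr hrq
    (by rw [Fintype.card_fin]; exact hmr) T hT jstar
  refine ⟨Fin.lastCases (motive := fun _ => Fin q) jstar π, ?_, fun i hi => ?_, fun j => ?_⟩
  · exact Fin.lastCases_last
  · obtain ⟨i', rfl⟩ : ∃ i' : Fin N, i'.castSucc = i := ⟨⟨i, hi⟩, rfl⟩
    rw [Fin.lastCases_castSucc]
    exact hTc i' (hπ i')
  · rw [CakeDivision.card_fiber_lastCases]
    have hqQ : (0 : ℚ) < q := by exact_mod_cast hq0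
    have hn : ((N + 1 : ℕ) : ℚ) = m * q + r := by exact_mod_cast hmr
    have hrQ : (0 : ℚ) < r := by exact_mod_cast hr
    have hceil : ⌈((N + 1 : ℕ) : ℚ) / q⌉ = (m : ℤ) + 1 := by
      have hrq' : (r : ℚ) ≤ q := by exact_mod_cast hrq
      rw [Int.ceil_eq_iff, lt_div_iff₀ hqQ, div_le_iff₀ hqQ, hn]
      push_cast
      constructor <;> linarith
    rw [hceil]
    by_cases hj : jstar = j
    · subst hj
      right
      rw [hπs, if_pos rfl]
      rfl
    rw [if_neg hj, add_zero]
    rcases hπj j (Ne.symm hj) with h | ⟨hlt, h⟩ <;> rw [h]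
    · right
      rfl
    · left
      symm
      have hrq' : (r : ℚ) < q := by exact_mod_cast hlt
      rw [Int.floor_eq_iff, le_div_iff₀ hqQ, div_lt_iff₀ hqQ, hn]
      push_cast
      constructor <;> linarith
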